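/- Let L be a positive definite, integral, strongly square free, totally-reflective ℤ-lattice of rank 4, and write det L = p₁²⋯p_r²·q₁⋯q_s with p₁, …, p_r, q₁, …, q_s pairwise distinct primes. Then r ≤ 9 and s ≤ 8 − r. -/

import Mathlib

open Matrix

/-- The bilinear form attached to a Gram matrix `G` on `ℤ^m`. -/
def Bf {m : ℕ} (G : Matrix (Fin m) (Fin m) ℤ) (x y : Fin m → ℤ) : ℤ :=
  x ⬝ᵥ G.mulVec y

/-- A vector of the lattice `ℤ^m` is primitive if it is not a proper multiple of a lattice
vector. -/
def PrimVec {m : ℕ} (v : Fin m → ℤ) : Prop :=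
  ∀ c : ℤ, 1 < c → ¬∃ w : Fin m → ℤ, c • w = v

/-- `v` is a root of the lattice `(ℤ^m, G)`: it is nonzero, primitive, and the associated
reflection `x ↦ x − (2·b(x,v)/b(v,v))·v` maps the lattice into itself. -/
def IsRootM {m : ℕ} (G : Matrix (Fin m) (Fin m) ℤ) (v : Fin m → ℤ) : Prop :=
  v ≠ 0 ∧ PrimVec v ∧
    ∀ x : Fin m → ℤ, ∃ y : Fin m → ℤ, ∀ i,
      (y i : ℚ) = (x i : ℚ) - 2 * (Bf G x v : ℚ) / (Bf G v v : ℚ) * (v i : ℚ)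

/-- The lattice `(ℤ^m, G)` is reflective if its roots span a sublattice of full rank. -/
def ReflectiveM {m : ℕ} (G : Matrix (Fin m) (Fin m) ℤ) : Prop :=
  Module.finrank ℤ (Submodule.span ℤ {v : Fin m → ℤ | IsRootM G v}) = m

/-- Positive definiteness of the Gram matrix `G`. -/
def PosDefM {m : ℕ} (G : Matrix (Fin m) (Fin m) ℤ) : Prop :=
  ∀ v : Fin m → ℤ, v ≠ 0 → 0 < Bf G v v

/-- Two integral lattices, given by Gram matrices, are in the same genus if the Gram
matrices are congruent over the ring `ℤ_p` of `p`-adic integers for every prime `p`. -/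
def SameGenusM {m : ℕ} (G₁ G₂ : Matrix (Fin m) (Fin m) ℤ) : Prop :=
  ∀ (p : ℕ) [Fact p.Prime],
    ∃ S : Matrix (Fin m) (Fin m) ℤ_[p], IsUnit S.det ∧
      Sᵀ * G₁.map (Int.cast : ℤ → ℤ_[p]) * S = G₂.map (Int.cast : ℤ → ℤ_[p])

/-- The lattice `(ℤ^m, G)` is totally-reflective if every lattice in its genus is
reflective. -/
def TotallyReflectiveM {m : ℕ} (G : Matrix (Fin m) (Fin m) ℤ) : Prop :=
  ∀ G' : Matrix (Fin m) (Fin m) ℤ, G'.IsSymm → PosDefM G' → SameGenusM G G' → ReflectiveM G'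

/-- The lattice `(ℤ^m, G)` is square free: all elementary divisors of `G` are square free. -/
def SquareFreeM {m : ℕ} (G : Matrix (Fin m) (Fin m) ℤ) : Prop :=
  ∃ (S T : Matrix (Fin m) (Fin m) ℤ) (d : Fin m → ℤ),
    IsUnit S.det ∧ IsUnit T.det ∧ S * G * T = Matrix.diagonal d ∧ ∀ i, Squarefree (d i)

/-- Strongly square free: square free and `v_p(det) ≤ m/2` for every prime `p`. -/
def StronglySquareFreeM {m : ℕ} (G : Matrix (Fin m) (Fin m) ℤ) : Prop :=
  SquareFreeM G ∧ ∀ p : ℕ, p.Prime → (G.det.natAbs).factorization p ≤ m / 2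


/-! ### Part 0: elementary algebra of the bilinear form -/

section NumPrimes

variable {G : Matrix (Fin 4) (Fin 4) ℤ}

theorem Bf_add_left {m : ℕ} (G : Matrix (Fin m) (Fin m) ℤ) (x y z : Fin m → ℤ) :
    Bf G (x + y) z = Bf G x z + Bf G y z := by
  simp [Bf, add_dotProduct]

theorem Bf_smul_left {m : ℕ} (G : Matrix (Fin m) (Fin m) ℤ) (c : ℤ) (x z : Fin m → ℤ) :
    Bf G (c • x) z = c * Bf G x z := by
  unfold Bf; rw [smul_dotProduct, smul_eq_mul]

theorem Bf_add_right {m : ℕ} (G : Matrix (Fin m) (Fin m) ℤ) (x y z : Fin m → ℤ) :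
    Bf G x (y + z) = Bf G x y + Bf G x z := by
  simp [Bf, mulVec_add, dotProduct_add]

theorem Bf_smul_right {m : ℕ} (G : Matrix (Fin m) (Fin m) ℤ) (c : ℤ) (x z : Fin m → ℤ) :
    Bf G x (c • z) = c * Bf G x z := by
  unfold Bf; rw [mulVec_smul, dotProduct_smul, smul_eq_mul]

theorem Bf_comm {m : ℕ} {G : Matrix (Fin m) (Fin m) ℤ} (hs : G.IsSymm) (x y : Fin m → ℤ) :
    Bf G x y = Bf G y x := by
  unfold Bf
  rw [dotProduct_mulVec, dotProduct_comm, ← mulVec_transpose, hs.eq]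

theorem Bf_single {m : ℕ} (G : Matrix (Fin m) (Fin m) ℤ) (i : Fin m) (x : Fin m → ℤ) :
    Bf G (Pi.single i 1) x = (G.mulVec x) i := by
  simp [Bf]

theorem Bf_zero_left {m : ℕ} (G : Matrix (Fin m) (Fin m) ℤ) (x : Fin m → ℤ) :
    Bf G 0 x = 0 := by
  simp [Bf]

theorem Bf_neg_left {m : ℕ} (G : Matrix (Fin m) (Fin m) ℤ) (x y : Fin m → ℤ) :
    Bf G (-x) y = - Bf G x y := by
  simp [Bf]

theorem Bf_neg_right {m : ℕ} (G : Matrix (Fin m) (Fin m) ℤ) (x y : Fin m → ℤ) :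
    Bf G x (-y) = - Bf G x y := by
  simp [Bf, mulVec_neg]

theorem Bf_sub_left {m : ℕ} (G : Matrix (Fin m) (Fin m) ℤ) (x y z : Fin m → ℤ) :
    Bf G (x - y) z = Bf G x z - Bf G y z := by
  rw [sub_eq_add_neg, Bf_add_left, Bf_neg_left]; ring

theorem Bf_sub_right {m : ℕ} (G : Matrix (Fin m) (Fin m) ℤ) (x y z : Fin m → ℤ) :
    Bf G x (y - z) = Bf G x y - Bf G x z := by
  rw [sub_eq_add_neg, Bf_add_right, Bf_neg_right]; ring

theorem Bf_nonneg {m : ℕ} {G : Matrix (Fin m) (Fin m) ℤ} (hp : PosDefM G) (x : Fin m → ℤ) :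
    0 ≤ Bf G x x := by
  by_cases h : x = 0
  · subst h; rw [Bf_zero_left]
  · exact (hp x h).le

/-- Divisibility property of a root: `b(v,v) ∣ 2 b(x,v)` for all `x`. -/
def RL {m : ℕ} (G : Matrix (Fin m) (Fin m) ℤ) (v : Fin m → ℤ) : Prop :=
  0 < Bf G v v ∧ ∀ x, Bf G v v ∣ 2 * Bf G x v

theorem prim_dvd {m : ℕ} {v : Fin m → ℤ} (hv : PrimVec v) (n t : ℤ) (hn : 0 < n)
    (h : ∀ i, n ∣ t * v i) : n ∣ t := by
  obtain ⟨g, n1, t1, hg, hc, rfl, rfl⟩ : ∃ g n1 t1 : ℤ, 0 < g ∧ IsCoprime n1 t1 ∧ n = g * n1 ∧ t = g * t1 := by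
    have hgpos : 0 < (Int.gcd n t : ℤ) := by
      have : Int.gcd n t ≠ 0 := by
        intro h0; rw [Int.gcd_eq_zero_iff] at h0; omega
      positivity
    refine ⟨Int.gcd n t, n / Int.gcd n t, t / Int.gcd n t, hgpos, ?_, ?_, ?_⟩
    · rw [Int.isCoprime_iff_gcd_eq_one]
      apply Int.gcd_ediv_gcd_ediv_gcd
      exact_mod_cast hgpos
    · exact (Int.mul_ediv_cancel' (Int.gcd_dvd_left ..)).symm
    · exact (Int.mul_ediv_cancel' (Int.gcd_dvd_right ..)).symm
  have hn1 : 0 < n1 := by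
    by_contra hh
    nlinarith
  have h1 : ∀ i, n1 ∣ v i := by
    intro i
    have := h i
    rw [mul_assoc] at this
    have := Int.dvd_of_mul_dvd_mul_left hg.ne' this
    exact hc.dvd_of_dvd_mul_left this
  rcases eq_or_lt_of_le (show (1:ℤ) ≤ n1 by omega) with h2 | h2
  · rw [← h2, mul_one]; exact dvd_mul_right _ _
  · exfalso
    choose f hf using h1
    exact hv n1 h2 ⟨f, by ext i; simp [hf i]⟩

theorem root_RL {m : ℕ} {G : Matrix (Fin m) (Fin m) ℤ} (hp : PosDefM G) {v : Fin m → ℤ}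
    (hv : IsRootM G v) : RL G v := by
  obtain ⟨h0, hprim, h⟩ := hv
  have hn := hp v h0
  refine ⟨hn, fun x => ?_⟩
  obtain ⟨y, hy⟩ := h x
  apply prim_dvd hprim _ _ hn
  intro i
  refine ⟨x i - y i, ?_⟩
  have hnq : (Bf G v v : ℚ) ≠ 0 := by exact_mod_cast hn.ne'
  have := hy i
  field_simp at this
  have h2 : (Bf G v v : ℚ) * (x i - y i) = 2 * Bf G x v * v i := by linarith
  have h3 : (Bf G v v) * (x i - y i) = 2 * Bf G x v * v i := by exact_mod_cast h2
  exact h3.symm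

/-- Cauchy-Schwarz. -/
theorem Bf_cs {m : ℕ} {G : Matrix (Fin m) (Fin m) ℤ} (hs : G.IsSymm) (hp : PosDefM G)
    (x y : Fin m → ℤ) (hy : 0 < Bf G y y) : Bf G x y ^ 2 ≤ Bf G x x * Bf G y y := by
  have h := Bf_nonneg hp (Bf G y y • x - Bf G x y • y)
  simp only [Bf_sub_left, Bf_sub_right, Bf_smul_left, Bf_smul_right, Bf_comm hs y x] at h
  nlinarith

theorem Bf_cs_strict {m : ℕ} {G : Matrix (Fin m) (Fin m) ℤ} (hs : G.IsSymm) (hp : PosDefM G)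
    (x y : Fin m → ℤ) (hy : 0 < Bf G y y)
    (hli : ∀ a b : ℤ, a • x + b • y = 0 → a = 0) : Bf G x y ^ 2 < Bf G x x * Bf G y y := by
  have hne : Bf G y y • x - Bf G x y • y ≠ 0 := by
    intro h0
    have := hli (Bf G y y) (-Bf G x y) (by rw [← h0]; simp [sub_eq_add_neg])
    omega
  have h := hp _ hne
  simp only [Bf_sub_left, Bf_sub_right, Bf_smul_left, Bf_smul_right, Bf_comm hs y x] at h
  nlinarith

/-- Nonorthogonal roots have the same prime divisors `p ≥ 5` of their norms. -/
theorem label_dvd (hs : G.IsSymm) (hp : PosDefM G) {v v' : Fin 4 → ℤ} (hv : RL G v)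
    (hv' : RL G v') (hb : Bf G v v' ≠ 0) {p : ℕ} (hpp : p.Prime) (h5 : 5 ≤ p)
    (hd : (p : ℤ) ∣ Bf G v v) : (p : ℤ) ∣ Bf G v' v' := by
  by_contra hnd
  have hcs := Bf_cs hs hp v v' hv'.1
  have h1 : Bf G v v ∣ 2 * Bf G v v' := by rw [Bf_comm hs v v']; exact hv.2 v'
  have h2 : Bf G v' v' ∣ 2 * Bf G v v' := hv'.2 v
  generalize hB : Bf G v v' = b at *
  generalize hN : Bf G v v = n at *
  generalize hN' : Bf G v' v' = n' at *
  have hn := hv.1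
  have hn' := hv'.1
  rw [hN] at hn
  rw [hN'] at hn'
  have hprime : Prime (p : ℤ) := Nat.prime_iff_prime_int.mp hpp
  have hg : (0 : ℤ) < Int.gcd n n' := by
    have : Int.gcd n n' ≠ 0 := by
      intro h0; rw [Int.gcd_eq_zero_iff] at h0; omega
    positivity
  obtain ⟨a, ha⟩ := Int.gcd_dvd_left n n'
  obtain ⟨a', ha'⟩ := Int.gcd_dvd_right n n'
  have hl : (Int.lcm n n' : ℤ) ∣ 2 * b := Int.coe_lcm_dvd h1 h2
  have hgl : (Int.gcd n n' : ℤ) * Int.lcm n n' = n * n' := by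
    have := Int.gcd_mul_lcm n n'
    have h3 : ((Int.gcd n n' * Int.lcm n n' : ℕ) : ℤ) = ((n * n').natAbs : ℤ) := by
      rw [this, Int.natAbs_mul]
    rw [Int.natAbs_of_nonneg (by positivity)] at h3
    exact_mod_cast h3
  generalize (Int.gcd n n' : ℤ) = g at *
  generalize (Int.lcm n n' : ℤ) = l at *
  have hpa : (p : ℤ) ∣ a := by
    rw [ha] at hd
    rcases hprime.dvd_or_dvd hd with h | h
    · exact absurd (ha' ▸ h.mul_right a') hnd
    · exact h
  have hapos : 0 < a := by by_contra hh; nlinarith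
  have hapos' : 0 < a' := by by_contra hh; nlinarith
  have hap : (5 : ℤ) ≤ a := by
    have := Int.le_of_dvd hapos hpa
    have : (5 : ℤ) ≤ p := by exact_mod_cast h5
    omega
  have hl' : l = g * (a * a') := by
    have : g * l = g * (g * (a * a')) := by rw [hgl, ha, ha']; ring
    exact mul_left_cancel₀ hg.ne' this
  obtain ⟨c, hc⟩ := hl
  have hcne : c ≠ 0 := by rintro rfl; apply hb; omega
  have hc1 : 1 ≤ c ^ 2 := by
    have : 0 < c ^ 2 := by positivity
    omega
  have hbb : 4 * b ^ 2 = l ^ 2 * c ^ 2 := by rw [← mul_pow, ← hc]; ring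
  have hl2 : l ^ 2 ≤ 4 * (n * n') := by nlinarith [sq_nonneg l]
  rw [hl', ha, ha'] at hl2
  have h6 : (g * g * (a * a')) * (a * a') ≤ (g * g * (a * a')) * 4 := by nlinarith
  have h7 : a * a' ≤ 4 := le_of_mul_le_mul_left h6 (by positivity)
  nlinarith

end NumPrimes

/-! ### Part 1: Cartan matrices of at most three roots -/

section Cartan

variable {G : Matrix (Fin 4) (Fin 4) ℤ}

theorem gram3_pos (hs : G.IsSymm) (hp : PosDefM G) (x y z : Fin 4 → ℤ)
    (hli : ∀ a b c : ℤ, a • x + b • y + c • z = 0 → a = 0 ∧ b = 0 ∧ c = 0) :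
    0 < Bf G x x * Bf G y y * Bf G z z + 2 * (Bf G x y * Bf G y z * Bf G x z)
      - Bf G x x * Bf G y z ^ 2 - Bf G y y * Bf G x z ^ 2 - Bf G z z * Bf G x y ^ 2 := by
  have hy : 0 < Bf G y y := by
    apply hp
    rintro rfl
    have := (hli 0 1 0 (by simp)).2.1
    omega
  have h2 : Bf G x y ^ 2 < Bf G x x * Bf G y y := by
    apply Bf_cs_strict hs hp x y hy
    intro a b h
    exact (hli a b 0 (by rw [zero_smul]; simpa only [zero_add, add_zero] using h)).1
  have hne : (Bf G x y * Bf G y z - Bf G y y * Bf G x z) • x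
      + (Bf G x y * Bf G x z - Bf G x x * Bf G y z) • y
      + (Bf G x x * Bf G y y - Bf G x y ^ 2) • z ≠ 0 := by
    intro h
    have := (hli _ _ _ h).2.2
    omega
  have h := hp _ hne
  simp only [Bf_add_left, Bf_add_right, Bf_smul_left, Bf_smul_right, Bf_comm hs y x,
    Bf_comm hs z x, Bf_comm hs z y] at h
  have h3 : 0 < (Bf G x x * Bf G y y - Bf G x y ^ 2) *
    (Bf G x x * Bf G y y * Bf G z z + 2 * (Bf G x y * Bf G y z * Bf G x z)
      - Bf G x x * Bf G y z ^ 2 - Bf G y y * Bf G x z ^ 2 - Bf G z z * Bf G x y ^ 2) := by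
    linarith
  exact (pos_iff_pos_of_mul_pos h3).mp (by linarith)

/-- If `a n' = 2 b = a' n` with `b ^ 2 < n n'`, then `a a' ∈ {0,1,2,3}`. -/
theorem aa_range {n n' b a a' : ℤ} (hn : 0 < n) (hn' : 0 < n') (h : a * n' = 2 * b)
    (h' : a' * n = 2 * b) (hb : b ^ 2 < n * n') : 0 ≤ a * a' ∧ a * a' ≤ 3 := by
  have e : (a * a') * (n * n') = 4 * b ^ 2 := by
    calc (a * a') * (n * n') = (a * n') * (a' * n) := by ring
      _ = 4 * b ^ 2 := by rw [h, h']; ring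
  have hnn : 0 < n * n' := by positivity
  constructor
  · by_contra hh
    nlinarith [sq_nonneg b]
  · by_contra hh
    nlinarith [sq_nonneg b]

theorem cartan_num (α β γ τ : ℤ) (h1 : 0 ≤ α ∧ α ≤ 3) (h2 : 0 ≤ β ∧ β ≤ 3)
    (h3 : 0 ≤ γ ∧ γ ≤ 3) (h : τ ^ 2 = α * β * γ) : τ ≤ α + β + γ := by
  obtain ⟨a1, a2⟩ := h1
  obtain ⟨b1, b2⟩ := h2
  obtain ⟨c1, c2⟩ := h3
  interval_cases α <;> interval_cases β <;> interval_cases γ <;> nlinarith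

/-- The Cartan matrix of three independent roots is invertible modulo `p ≥ 5`. -/
theorem cartan3 (hs : G.IsSymm) (hp : PosDefM G) (x : Fin 3 → Fin 4 → ℤ)
    (hx : ∀ i, 0 < Bf G (x i) (x i))
    (hli : ∀ a b c : ℤ, a • x 0 + b • x 1 + c • x 2 = 0 → a = 0 ∧ b = 0 ∧ c = 0)
    (A : Fin 3 → Fin 3 → ℤ) (hA : ∀ i j, A i j * Bf G (x j) (x j) = 2 * Bf G (x i) (x j))
    {p : ℕ} (hpp : p.Prime) (h5 : 5 ≤ p) (c : Fin 3 → ℤ)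
    (hc : ∀ j, (p : ℤ) ∣ c 0 * A 0 j + c 1 * A 1 j + c 2 * A 2 j) :
    (p : ℤ) ∣ c 0 ∧ (p : ℤ) ∣ c 1 ∧ (p : ℤ) ∣ c 2 := by
  have hg := gram3_pos hs hp (x 0) (x 1) (x 2) hli
  have s01 : Bf G (x 0) (x 1) ^ 2 < Bf G (x 0) (x 0) * Bf G (x 1) (x 1) :=
    Bf_cs_strict hs hp _ _ (hx 1) fun a b h => (hli a b 0 (by rw [zero_smul]; simpa only [zero_add, add_zero] using h)).1
  have s02 : Bf G (x 0) (x 2) ^ 2 < Bf G (x 0) (x 0) * Bf G (x 2) (x 2) :=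
    Bf_cs_strict hs hp _ _ (hx 2) fun a b h => (hli a 0 b (by rw [zero_smul]; simpa only [zero_add, add_zero] using h)).1
  have s12 : Bf G (x 1) (x 2) ^ 2 < Bf G (x 1) (x 1) * Bf G (x 2) (x 2) :=
    Bf_cs_strict hs hp _ _ (hx 2) fun a b h => (hli 0 a b (by rw [zero_smul]; simpa only [zero_add, add_zero] using h)).2.1
  have a00 := hA 0 0
  have a11 := hA 1 1
  have a22 := hA 2 2
  have a01 := hA 0 1
  have a02 := hA 0 2
  have a12 := hA 1 2
  have a10 := hA 1 0
  have a20 := hA 2 0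
  have a21 := hA 2 1
  rw [Bf_comm hs (x 1) (x 0)] at a10
  rw [Bf_comm hs (x 2) (x 0)] at a20
  rw [Bf_comm hs (x 2) (x 1)] at a21
  have q0 := hx 0
  have q1 := hx 1
  have q2 := hx 2
  have c0 := hc 0
  have c1 := hc 1
  have c2 := hc 2
  generalize Bf G (x 0) (x 0) = n0 at *
  generalize Bf G (x 1) (x 1) = n1 at *
  generalize Bf G (x 2) (x 2) = n2 at *
  generalize Bf G (x 0) (x 1) = b01 at *
  generalize Bf G (x 0) (x 2) = b02 at *
  generalize Bf G (x 1) (x 2) = b12 at *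
  generalize A 0 1 = A01 at *
  generalize A 0 2 = A02 at *
  generalize A 1 2 = A12 at *
  generalize A 1 0 = A10 at *
  generalize A 2 0 = A20 at *
  generalize A 2 1 = A21 at *
  have e0 : A 0 0 = 2 := mul_right_cancel₀ q0.ne' a00
  have e1 : A 1 1 = 2 := mul_right_cancel₀ q1.ne' a11
  have e2 : A 2 2 = 2 := mul_right_cancel₀ q2.ne' a22
  rw [e0] at c0
  rw [e1] at c1
  rw [e2] at c2
  have r01 := aa_range q0 q1 a01 a10 s01
  have r02 := aa_range q0 q2 a02 a20 s02
  have r12 := aa_range q1 q2 a12 a21 s12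
  have t : A01 * A12 * A20 = A10 * A21 * A02 := by
    have : (A01 * A12 * A20) * (n0 * n1 * n2) = (A10 * A21 * A02) * (n0 * n1 * n2) := by
      calc _ = (A01 * n1) * (A12 * n2) * (A20 * n0) := by ring
        _ = (A10 * n0) * (A21 * n1) * (A02 * n2) := by
          rw [a01, a12, a20, a10, a21, a02]
        _ = _ := by ring
    exact mul_right_cancel₀ (by positivity) this
  have hup := cartan_num _ _ _ (A01 * A12 * A20) r01 r02 r12 (by
    rw [sq]; nth_rewrite 2 [t]; ring)
  have hlow : 0 < 4 - A01 * A10 - A02 * A20 - A12 * A21 + A01 * A12 * A20 := by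
    have key : (4 - A01 * A10 - A02 * A20 - A12 * A21 + A01 * A12 * A20) * (n0 * n1 * n2) =
      4 * (n0 * n1 * n2 + 2 * (b01 * b12 * b02) - n0 * b12 ^ 2 - n1 * b02 ^ 2 - n2 * b01 ^ 2) := by
      have i1 : (A01 * n1) * (A10 * n0) = 4 * b01 ^ 2 := by rw [a01, a10]; ring
      have i2 : (A02 * n2) * (A20 * n0) = 4 * b02 ^ 2 := by rw [a02, a20]; ring
      have i3 : (A12 * n2) * (A21 * n1) = 4 * b12 ^ 2 := by rw [a12, a21]; ring
      have i4 : (A01 * n1) * (A12 * n2) * (A20 * n0) = 8 * (b01 * b12 * b02) := by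
        rw [a01, a12, a20]; ring
      linear_combination (-n2) * i1 - n1 * i2 - n0 * i3 + i4
    by_contra hh
    have : (4 - A01 * A10 - A02 * A20 - A12 * A21 + A01 * A12 * A20) * (n0 * n1 * n2) ≤ 0 :=
      mul_nonpos_of_nonpos_of_nonneg (by omega) (by positivity)
    linarith
  set E := 4 - A01 * A10 - A02 * A20 - A12 * A21 + A01 * A12 * A20 with hE
  have hE4 : E ≤ 4 := by omega
  have hprime : Prime (p : ℤ) := Nat.prime_iff_prime_int.mp hpp
  have h5' : (5 : ℤ) ≤ p := by exact_mod_cast h5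
  have hn : ¬ (p : ℤ) ∣ 2 * E := by
    intro h
    rcases hprime.dvd_or_dvd h with h | h
    · have := Int.le_of_dvd (by norm_num) h
      omega
    · have := Int.le_of_dvd hlow h
      omega
  have fin : ∀ c : ℤ, (p : ℤ) ∣ c * (2 * E) → (p : ℤ) ∣ c := fun c h =>
    (hprime.dvd_or_dvd h).resolve_right hn
  refine ⟨fin _ ?_, fin _ ?_, fin _ ?_⟩
  · have : c 0 * (2 * E) = (c 0 * 2 + c 1 * A10 + c 2 * A20) * (4 - A12 * A21)
      + (c 0 * A01 + c 1 * 2 + c 2 * A21) * (A20 * A12 - 2 * A10)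
      + (c 0 * A02 + c 1 * A12 + c 2 * 2) * (A10 * A21 - 2 * A20) := by
      rw [hE]; linear_combination (-c 0) * t + 2 * c 0 * t
    rw [this]
    exact dvd_add (dvd_add (c0.mul_right _) (c1.mul_right _)) (c2.mul_right _)
  · have : c 1 * (2 * E) = (c 0 * 2 + c 1 * A10 + c 2 * A20) * (A02 * A21 - 2 * A01)
      + (c 0 * A01 + c 1 * 2 + c 2 * A21) * (4 - A02 * A20)
      + (c 0 * A02 + c 1 * A12 + c 2 * 2) * (A20 * A01 - 2 * A21) := by
      rw [hE]; linear_combination c 1 * t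
    rw [this]
    exact dvd_add (dvd_add (c0.mul_right _) (c1.mul_right _)) (c2.mul_right _)
  · have : c 2 * (2 * E) = (c 0 * 2 + c 1 * A10 + c 2 * A20) * (A01 * A12 - 2 * A02)
      + (c 0 * A01 + c 1 * 2 + c 2 * A21) * (A10 * A02 - 2 * A12)
      + (c 0 * A02 + c 1 * A12 + c 2 * 2) * (4 - A01 * A10) := by
      rw [hE]; linear_combination c 2 * t
    rw [this]
    exact dvd_add (dvd_add (c0.mul_right _) (c1.mul_right _)) (c2.mul_right _)

end Cartan

/-! ### Part 2: the divisors of the norms of four independent roots -/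

section FourRoots

variable {G : Matrix (Fin 4) (Fin 4) ℤ}

theorem dvd_mulVec {n : ℕ} (M : Matrix (Fin n) (Fin n) ℤ) {m : ℤ} {x : Fin n → ℤ}
    (h : ∀ k, m ∣ x k) (i : Fin n) : m ∣ (M.mulVec x) i := by
  unfold mulVec dotProduct
  exact Finset.dvd_sum fun k _ => (h k).mul_left _

theorem sf_dvd (h : SquareFreeM G) {p : ℕ} (hp : p.Prime) (v : Fin 4 → ℤ)
    (hv : ∀ i, (p : ℤ) ^ 2 ∣ (G.mulVec v) i) (i : Fin 4) : (p : ℤ) ∣ v i := by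
  obtain ⟨S, T, d, hS, hT, hd, hsq⟩ := h
  have hprime : Prime (p : ℤ) := Nat.prime_iff_prime_int.mp hp
  have hTT : T * T⁻¹ = 1 := Matrix.mul_nonsing_inv _ hT
  set y := T⁻¹.mulVec v with hy
  have hvy : v = T.mulVec y := by rw [hy, mulVec_mulVec, hTT, one_mulVec]
  have h1 : ∀ j, (p : ℤ) ∣ y j := by
    intro j
    have h2 : (p : ℤ) ^ 2 ∣ d j * y j := by
      have h3 : d j * y j = (S.mulVec (G.mulVec v)) j := by
        rw [hvy, mulVec_mulVec, mulVec_mulVec, hd, mulVec_diagonal]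
      rw [h3]
      exact dvd_mulVec _ hv _
    by_contra hn
    have h4 : IsCoprime ((p : ℤ) ^ 2) (y j) :=
      ((Prime.coprime_iff_not_dvd hprime).2 hn).pow_left
    have h5 := h4.dvd_of_dvd_mul_right h2
    rw [sq] at h5
    exact hprime.not_isUnit (hsq j _ h5)
  rw [hvy]
  exact dvd_mulVec _ h1 _

theorem ker_dep (h : SquareFreeM G) {p : ℕ} (hp : p.Prime) (hD : ¬ (p : ℤ) ^ 3 ∣ G.det)
    (x : Fin 3 → Fin 4 → ℤ) (hx : ∀ k i, (p : ℤ) ∣ (G.mulVec (x k)) i) :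
    ∃ c : Fin 3 → ℤ, (∃ k, ¬ (p : ℤ) ∣ c k) ∧ ∀ i, (p : ℤ) ∣ ∑ k, c k * x k i := by
  obtain ⟨S, T, d, hS, hT, hd, hsq⟩ := h
  have : Fact p.Prime := ⟨hp⟩
  have hprime : Prime (p : ℤ) := Nat.prime_iff_prime_int.mp hp
  have hTT : T * T⁻¹ = 1 := Matrix.mul_nonsing_inv _ hT
  have hdet : (∏ i, d i) ∣ G.det := by
    have h1 : S.det * G.det * T.det = ∏ i, d i := by
      rw [← det_mul, ← det_mul, hd, det_diagonal]
    rw [← h1]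
    rw [hT.mul_right_dvd, hS.mul_left_dvd]
  set I := (Finset.univ : Finset (Fin 4)).filter (fun i => (p : ℤ) ∣ d i) with hI
  have hcard : I.card < 3 := by
    by_contra hh
    apply hD
    refine dvd_trans ?_ hdet
    have h1 : (p : ℤ) ^ I.card ∣ ∏ i ∈ I, d i := by
      rw [← Finset.prod_const]
      exact Finset.prod_dvd_prod_of_dvd _ _ fun i hi => (Finset.mem_filter.1 hi).2
    exact ((pow_dvd_pow _ (by omega)).trans h1).trans
      (Finset.prod_dvd_prod_of_subset _ _ _ (Finset.subset_univ _))
  set y : Fin 3 → Fin 4 → ℤ := fun k => T⁻¹.mulVec (x k) with hy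
  have hvy : ∀ k, x k = T.mulVec (y k) := by
    intro k; simp only [hy]; rw [mulVec_mulVec, hTT, one_mulVec]
  have h1 : ∀ k j, j ∉ I → (p : ℤ) ∣ y k j := by
    intro k j hj
    have h2 : (p : ℤ) ∣ d j * y k j := by
      have h3 : d j * y k j = (S.mulVec (G.mulVec (x k))) j := by
        rw [hvy, mulVec_mulVec, mulVec_mulVec, hd, mulVec_diagonal]
      rw [h3]
      exact dvd_mulVec _ (hx k) _
    exact (hprime.dvd_or_dvd h2).resolve_left fun h => hj (by simp [hI, h])
  let f : (Fin 3 → ZMod p) →ₗ[ZMod p] (I → ZMod p) :=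
    Matrix.mulVecLin (Matrix.of fun (i : I) (k : Fin 3) => ((y k i : ℤ) : ZMod p))
  obtain ⟨c, hc, hc0⟩ : ∃ c, f c = 0 ∧ c ≠ 0 := by
    have hnot : LinearMap.ker f ≠ ⊥ := by
      apply LinearMap.ker_ne_bot_of_finrank_lt
      simpa using hcard
    obtain ⟨c, hc, h0⟩ := Submodule.exists_mem_ne_zero_of_ne_bot hnot
    exact ⟨c, hc, h0⟩
  have hval : ∀ a : ZMod p, ((a.val : ℤ) : ZMod p) = a := by intro a; simp
  refine ⟨fun k => (c k).val, ?_, ?_⟩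
  · by_contra hh
    push Not at hh
    apply hc0
    ext k
    have := (ZMod.intCast_zmod_eq_zero_iff_dvd _ p).2 (hh k)
    rw [hval] at this
    simpa using this
  · have h2 : ∀ j, (p : ℤ) ∣ ∑ k, ((c k).val : ℤ) * y k j := by
      intro j
      by_cases hj : j ∈ I
      · rw [← ZMod.intCast_zmod_eq_zero_iff_dvd]
        have := congrFun hc ⟨j, hj⟩
        simp only [f, mulVecLin_apply, mulVec, dotProduct, of_apply, Pi.zero_apply] at this
        push_cast
        rw [← this]
        refine Finset.sum_congr rfl fun k _ => ?_
        simp [mul_comm]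
      · exact Finset.dvd_sum fun k _ => (h1 k j hj).mul_left _
    intro i
    have h3 : ∑ k, ((c k).val : ℤ) * x k i = ∑ j, T i j * ∑ k, ((c k).val : ℤ) * y k j := by
      simp only [hvy, mulVec, dotProduct, Finset.mul_sum]
      rw [Finset.sum_comm]
      refine Finset.sum_congr rfl fun j _ => Finset.sum_congr rfl fun k _ => ?_
      ring
    rw [h3]
    exact Finset.dvd_sum fun j _ => (h2 j).mul_left _

theorem root_sq_ndvd (hp : PosDefM G) (hsf : SquareFreeM G) {v : Fin 4 → ℤ} (hv : IsRootM G v)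
    {p : ℕ} (hpp : p.Prime) (h5 : 5 ≤ p) : ¬ (p : ℤ) ^ 2 ∣ Bf G v v := by
  intro h
  have hr := root_RL hp hv
  have hprime : Prime (p : ℤ) := Nat.prime_iff_prime_int.mp hpp
  have h2 : ¬ (p : ℤ) ∣ 2 := by
    intro h; have := Int.le_of_dvd (by norm_num) h; omega
  have h1 : ∀ i, (p : ℤ) ∣ v i := by
    apply sf_dvd hsf hpp
    intro i
    have := h.trans (hr.2 (Pi.single i 1))
    rw [Bf_single] at this
    exact (((Prime.coprime_iff_not_dvd hprime).2 h2).pow_left).dvd_of_dvd_mul_left this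
  choose f hf using h1
  refine hv.2.1 p (by omega) ⟨f, ?_⟩
  ext i; simp [hf i]

theorem root_dvd_mulVec {v : Fin 4 → ℤ} (hr : RL G v)
    {p : ℕ} (hpp : p.Prime) (h5 : 5 ≤ p) (h : (p : ℤ) ∣ Bf G v v) (i : Fin 4) :
    (p : ℤ) ∣ (G.mulVec v) i := by
  have hprime : Prime (p : ℤ) := Nat.prime_iff_prime_int.mp hpp
  have h2 : ¬ (p : ℤ) ∣ 2 := by
    intro h; have := Int.le_of_dvd (by norm_num) h; omega
  have := h.trans (hr.2 (Pi.single i 1))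
  rw [Bf_single] at this
  exact (hprime.dvd_or_dvd this).resolve_left h2

theorem li_three {v : Fin 4 → Fin 4 → ℤ} (hli : LinearIndependent ℤ v) (k : Fin 4) (a b c : ℤ)
    (h : a • v (k.succAbove 0) + b • v (k.succAbove 1) + c • v (k.succAbove 2) = 0) :
    a = 0 ∧ b = 0 ∧ c = 0 := by
  have h1 := hli.comp _ (Fin.succAbove_right_injective (p := k))
  rw [Fintype.linearIndependent_iff] at h1
  have h2 := h1 ![a, b, c] (by rw [Fin.sum_univ_three]; exact h)
  exact ⟨h2 0, h2 1, h2 2⟩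

theorem half_block (hs : G.IsSymm) (hp : PosDefM G) {v : Fin 4 → Fin 4 → ℤ}
    (hv : ∀ i, RL G (v i)) (hli : LinearIndependent ℤ v)
    (A : Fin 4 → Fin 4 → ℤ) (hA : ∀ i j, A i j * Bf G (v j) (v j) = 2 * Bf G (v i) (v j))
    (S : Finset (Fin 4)) (hS : ∃ k, k ∉ S) (hb : ∀ i ∈ S, ∀ j ∉ S, Bf G (v i) (v j) = 0)
    {p : ℕ} (hpp : p.Prime) (h5 : 5 ≤ p) (c : Fin 4 → ℤ)
    (hc : ∀ j, (p : ℤ) ∣ ∑ i, c i * A i j) : ∀ i ∈ S, (p : ℤ) ∣ c i := by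
  obtain ⟨k, hk⟩ := hS
  have hA0 : ∀ i j, Bf G (v i) (v j) = 0 → A i j = 0 := by
    intro i j h
    have := hA i j
    rw [h, mul_zero] at this
    exact (mul_eq_zero.1 this).resolve_right (hv j).1.ne'
  have hA1 : ∀ i ∈ S, ∀ j ∉ S, A i j = 0 := fun i hi j hj => hA0 _ _ (hb i hi j hj)
  have hA2 : ∀ i ∉ S, ∀ j ∈ S, A i j = 0 := fun i hi j hj =>
    hA0 _ _ (by rw [Bf_comm hs]; exact hb j hj i hi)
  have key := cartan3 hs hp (fun i => v (k.succAbove i)) (fun i => (hv _).1) (li_three hli k)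
    (fun i j => A (k.succAbove i) (k.succAbove j)) (fun i j => hA _ _) hpp h5
    (fun i => if k.succAbove i ∈ S then c (k.succAbove i) else 0) (by
      intro j
      have h3 : ∀ i : Fin 3, (if k.succAbove i ∈ S then c (k.succAbove i) else 0) *
          A (k.succAbove i) (k.succAbove j) = if k.succAbove j ∈ S then
          c (k.succAbove i) * A (k.succAbove i) (k.succAbove j) else 0 := by
        intro i
        by_cases h1 : k.succAbove i ∈ S <;> by_cases h2 : k.succAbove j ∈ S
        · simp [h1, h2]
        · simp [h1, h2, hA1 _ h1 _ h2]
        · simp [h1, h2, hA2 _ h1 _ h2]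
        · simp [h1, h2]
      simp only [h3]
      by_cases h2 : k.succAbove j ∈ S
      · have := hc (k.succAbove j)
        rw [Fin.sum_univ_succAbove _ k, hA2 k hk _ h2, mul_zero, zero_add,
          Fin.sum_univ_three] at this
        simpa [h2] using this
      · simp [h2])
  intro i hi
  obtain ⟨i', rfl⟩ := Fin.exists_succAbove_eq (show i ≠ k by rintro rfl; exact hk hi)
  have key' : ∀ i' : Fin 3, (p : ℤ) ∣ if k.succAbove i' ∈ S then c (k.succAbove i') else 0 := by
    intro i'
    fin_cases i'
    · exact key.1
    · exact key.2.1
    · exact key.2.2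
  have := key' i'
  rwa [if_pos hi] at this

end FourRoots

section FourRootsCount

variable {G : Matrix (Fin 4) (Fin 4) ℤ}

theorem Bf_sum_left {ι : Type*} (s : Finset ι) (f : ι → Fin 4 → ℤ) (y : Fin 4 → ℤ) :
    Bf G (∑ i ∈ s, f i) y = ∑ i ∈ s, Bf G (f i) y := by
  unfold Bf; rw [sum_dotProduct]

theorem pair_dvd {ι : Type*} [Fintype ι] {v : ι → Fin 4 → ℤ} (hv : ∀ i, RL G (v i))
    (A : ι → ι → ℤ) (hA : ∀ i j, A i j * Bf G (v j) (v j) = 2 * Bf G (v i) (v j))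
    (p : ℤ) (c : ι → ℤ) (hc : ∀ l, p ∣ ∑ k, c k * v k l) (j : ι) :
    p ∣ ∑ i, c i * A i j := by
  choose y hy using hc
  have h1 : ∑ k, c k • v k = p • y := by
    ext l
    simp [hy l]
  have h2 : (∑ i, c i * A i j) * Bf G (v j) (v j) = p * (2 * Bf G y (v j)) := by
    have h3 : Bf G (∑ k, c k • v k) (v j) = ∑ k, c k * Bf G (v k) (v j) := by
      rw [Bf_sum_left]; simp only [Bf_smul_left]
    rw [h1, Bf_smul_left] at h3
    rw [Finset.sum_mul]
    calc ∑ i, c i * A i j * Bf G (v j) (v j) = ∑ i, 2 * (c i * Bf G (v i) (v j)) := by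
          refine Finset.sum_congr rfl fun i _ => ?_
          rw [mul_assoc, hA]; ring
      _ = 2 * ∑ i, c i * Bf G (v i) (v j) := by rw [Finset.mul_sum]
      _ = _ := by rw [← h3]; ring
  obtain ⟨t, ht⟩ := (hv j).2 y
  refine ⟨t, mul_right_cancel₀ (hv j).1.ne' (h2.trans ?_)⟩
  rw [ht]; ring

theorem entry_le {n n' b a a' : ℤ} (hn : 0 < n) (hn' : 0 < n') (h : a * n' = 2 * b)
    (h' : a' * n = 2 * b) (hb : b ^ 2 ≤ n * n') : |a| ≤ 4 := by
  have e : (a * a') * (n * n') = 4 * b ^ 2 := by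
    calc (a * a') * (n * n') = (a * n') * (a' * n) := by ring
      _ = 4 * b ^ 2 := by rw [h, h']; ring
  have hnn : 0 < n * n' := by positivity
  have h4 : a * a' ≤ 4 := by
    by_contra hh
    nlinarith [sq_nonneg b]
  have h0 : 0 ≤ a * a' := by
    by_contra hh
    nlinarith [sq_nonneg b]
  rcases eq_or_ne a' 0 with ha | ha
  · subst ha
    have : b = 0 := by linarith
    subst this
    have : a = 0 := by
      rw [mul_zero] at h
      rcases mul_eq_zero.1 h with h | h
      · exact h
      · omega
    subst this; norm_num
  · have h1 : 1 ≤ |a'| := Int.one_le_abs ha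
    have h2 : |a| * |a'| ≤ 4 := by rw [← abs_mul, abs_of_nonneg h0]; exact h4
    nlinarith [abs_nonneg a]

theorem four_roots (hs : G.IsSymm) (hp : PosDefM G) (hsf : SquareFreeM G)
    {v : Fin 4 → Fin 4 → ℤ} (hv : ∀ i, IsRootM G (v i)) (hli : LinearIndependent ℤ v)
    (P : Finset ℕ) (hP : ∀ p ∈ P, p.Prime ∧ 5 ≤ p ∧ (p : ℤ) ∣ G.det ∧ ¬ (p : ℤ) ^ 3 ∣ G.det)
    (hbig : 6144 < ∏ p ∈ P, p) (hD : G.det ≠ 0) (p : ℕ) (hpp : p.Prime) (h5 : 5 ≤ p) :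
    ((Finset.univ : Finset (Fin 4)).filter (fun i => (p : ℤ) ∣ Bf G (v i) (v i))).card
      = padicValInt p G.det := by
  have hr : ∀ i, RL G (v i) := fun i => root_RL hp (hv i)
  have hA' : ∀ i j, ∃ a, a * Bf G (v j) (v j) = 2 * Bf G (v i) (v j) := by
    intro i j
    obtain ⟨a, ha⟩ := (hr j).2 (v i)
    exact ⟨a, by rw [ha]; ring⟩
  choose A hA using hA'
  set V : Matrix (Fin 4) (Fin 4) ℤ := Matrix.of v with hV
  have hVdet : V.det ≠ 0 := by
    intro h0
    obtain ⟨c, hc0, hc⟩ := Matrix.exists_vecMul_eq_zero_iff.2 h0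
    apply hc0
    rw [Fintype.linearIndependent_iff] at hli
    ext i
    refine hli c ?_ i
    rw [← hc]
    ext l
    simp [vecMul, dotProduct, hV]
  have hdet : (Matrix.of A).det * ∏ j, Bf G (v j) (v j) = 16 * (V.det ^ 2 * G.det) := by
    have h1 : Matrix.of A * diagonal (fun j => Bf G (v j) (v j)) = (2 : ℤ) • (V * G * Vᵀ) := by
      ext i j
      rw [mul_diagonal, Matrix.smul_apply, mul_assoc, smul_eq_mul]
      exact hA i j
    have h2 := congrArg Matrix.det h1
    rw [det_mul, det_diagonal, det_smul, det_mul, det_mul, det_transpose, Fintype.card_fin] at h2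
    rw [h2]; ring
  have hdetA : (Matrix.of A).det ≠ 0 := by
    intro h0
    rw [h0, zero_mul] at hdet
    have : V.det ^ 2 * G.det ≠ 0 := mul_ne_zero (pow_ne_zero _ hVdet) hD
    omega
  have h16 : ∀ p : ℕ, 5 ≤ p → p.Prime → ¬ (p : ℤ) ∣ 16 := by
    intro p h5 hpp h
    have h2 : (p : ℤ) ∣ 2 := by
      apply (Nat.prime_iff_prime_int.mp hpp).dvd_of_dvd_pow (n := 4)
      simpa using h
    have := Int.le_of_dvd (by norm_num) h2
    omega
  obtain ⟨p', hp'P, i0, hi0⟩ : ∃ p' ∈ P, ∃ i, (p' : ℤ) ∣ Bf G (v i) (v i) := by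
    by_contra hh
    push Not at hh
    have h1 : ∏ p ∈ P, p ∣ (Matrix.of A).det.natAbs := by
      apply Finset.prod_primes_dvd
      · intro a ha; exact (hP a ha).1.prime
      · intro a ha
        have hprime := Nat.prime_iff_prime_int.mp (hP a ha).1
        have h2 : (a : ℤ) ∣ (Matrix.of A).det * ∏ j, Bf G (v j) (v j) := by
          rw [hdet]
          exact ((hP a ha).2.2.1.mul_left _).mul_left _
        rcases hprime.dvd_or_dvd h2 with h | h
        · exact Int.natCast_dvd.1 h
        · obtain ⟨j, -, hj⟩ := (Prime.dvd_finsetProd_iff hprime _).1 h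
          exact absurd hj (hh a ha j)
    have h2 : |(Matrix.of A).det| ≤ 6144 := by
      have := Matrix.det_le (A := Matrix.of A) (abv := AbsoluteValue.abs) (x := 4) (by
        intro i j
        exact entry_le (hr i).1 (hr j).1 (hA i j) ((hA j i).trans (by rw [Bf_comm hs]))
          (Bf_cs hs hp _ _ (hr j).1))
      simp only [AbsoluteValue.abs_apply, Fintype.card_fin] at this
      norm_num [Nat.factorial] at this
      exact this
    have h3 := Nat.le_of_dvd (Int.natAbs_pos.2 hdetA) h1
    have h4 : ((Matrix.of A).det.natAbs : ℤ) ≤ 6144 := by rw [Int.natCast_natAbs]; exact h2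
    omega
  obtain ⟨i1, hi1⟩ : ∃ i, ¬ (p' : ℤ) ∣ Bf G (v i) (v i) := by
    by_contra hh
    push Not at hh
    obtain ⟨hp1, hp2, hp3, hp4⟩ := hP p' hp'P
    obtain ⟨c, ⟨k, hk⟩, hc⟩ := ker_dep hsf hp1 hp4 (fun i => v ((3 : Fin 4).succAbove i))
      (fun k => root_dvd_mulVec (hr _) hp1 hp2 (hh _))
    have h1 := pair_dvd (v := fun i => v ((3 : Fin 4).succAbove i)) (fun i => hr _)
      (fun i j => A ((3 : Fin 4).succAbove i) ((3 : Fin 4).succAbove j)) (fun i j => hA _ _) p' c hc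
    simp only [Fin.sum_univ_three] at h1
    have h2 := cartan3 hs hp (fun i => v ((3 : Fin 4).succAbove i)) (fun i => (hr _).1)
      (li_three hli 3) _ (fun i j => hA _ _) hp1 hp2 c h1
    apply hk
    fin_cases k
    · exact h2.1
    · exact h2.2.1
    · exact h2.2.2
  obtain ⟨hp1, hp2, hp3, hp4⟩ := hP p' hp'P
  set S := (Finset.univ : Finset (Fin 4)).filter (fun i => (p' : ℤ) ∣ Bf G (v i) (v i)) with hS
  have hSmem : ∀ i, i ∈ S ↔ (p' : ℤ) ∣ Bf G (v i) (v i) := by intro i; simp [hS]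
  have hb : ∀ i ∈ S, ∀ j ∉ S, Bf G (v i) (v j) = 0 := by
    intro i hi j hj
    by_contra hne
    exact hj ((hSmem j).2 (label_dvd hs hp (hr i) (hr j) hne hp1 hp2 ((hSmem i).1 hi)))
  have hinv : ∀ c : Fin 4 → ℤ, (∀ j, (p : ℤ) ∣ ∑ i, c i * A i j) → ∀ i, (p : ℤ) ∣ c i := by
    intro c hc i
    by_cases hi : i ∈ S
    · exact half_block hs hp hr hli A hA S ⟨i1, fun h => hi1 ((hSmem _).1 h)⟩ hb hpp h5 c hc i hi
    · refine half_block hs hp hr hli A hA Sᶜ ⟨i0, ?_⟩ ?_ hpp h5 c hc i (by simpa using hi)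
      · simpa using (hSmem _).2 hi0
      · intro i hi j hj
        rw [Bf_comm hs]
        exact hb j (by simpa using hj) i (by simpa using hi)
  have : Fact p.Prime := ⟨hpp⟩
  have hprime := Nat.prime_iff_prime_int.mp hpp
  have hgen : ∀ M : Matrix (Fin 4) (Fin 4) ℤ,
      (∀ c : Fin 4 → ℤ, (∀ j, (p : ℤ) ∣ ∑ i, c i * M i j) → ∀ i, (p : ℤ) ∣ c i) →
      ¬ (p : ℤ) ∣ M.det := by
    intro M hM h
    rw [← ZMod.intCast_zmod_eq_zero_iff_dvd] at h
    have h1 : (M.map (Int.cast : ℤ → ZMod p)).det = 0 := by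
      rw [← h]
      exact ((Int.castRingHom (ZMod p)).map_det M).symm
    obtain ⟨c, hc0, hc⟩ := Matrix.exists_vecMul_eq_zero_iff.2 h1
    have hval : ∀ a : ZMod p, ((a.val : ℤ) : ZMod p) = a := by intro a; simp
    apply hc0
    ext i
    have := hM (fun i => (c i).val) (by
      intro j
      rw [← ZMod.intCast_zmod_eq_zero_iff_dvd]
      have := congrFun hc j
      simp only [vecMul, dotProduct, map_apply, Pi.zero_apply] at this
      push_cast
      rw [← this]
      refine Finset.sum_congr rfl fun k _ => ?_
      simp) i
    rw [← ZMod.intCast_zmod_eq_zero_iff_dvd, hval] at this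
    exact this
  have hnA : ¬ (p : ℤ) ∣ (Matrix.of A).det := hgen _ (by intro c hc; exact hinv c hc)
  have hnV : ¬ (p : ℤ) ∣ V.det := hgen _ (by
    intro c hc
    apply hinv
    exact pair_dvd hr A hA p c hc)
  have hQ0 : ∀ j, Bf G (v j) (v j) ≠ 0 := fun j => (hr j).1.ne'
  have hval := congrArg (padicValInt p) hdet
  have hV2 : V.det ^ 2 ≠ 0 := pow_ne_zero _ hVdet
  rw [padicValInt.mul hdetA (Finset.prod_ne_zero_iff.2 fun j _ => hQ0 j),
    padicValInt.mul (by norm_num) (mul_ne_zero hV2 hD), padicValInt.mul hV2 hD,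
    padicValInt.eq_zero_of_not_dvd hnA, padicValInt.eq_zero_of_not_dvd (h16 p h5 hpp),
    padicValInt.eq_zero_of_not_dvd (fun h => hnV (hprime.dvd_of_dvd_pow h))] at hval
  simp only [zero_add] at hval
  rw [← hval, Fin.prod_univ_four, padicValInt.mul (by simp [hQ0]) (hQ0 3),
    padicValInt.mul (by simp [hQ0]) (hQ0 2), padicValInt.mul (hQ0 0) (hQ0 1), Finset.card_filter,
    Fin.sum_univ_four]
  have hone : ∀ j, (if (p : ℤ) ∣ Bf G (v j) (v j) then 1 else 0)
      = padicValInt p (Bf G (v j) (v j)) := by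
    intro j
    split_ifs with h
    · apply le_antisymm
      · by_contra hh
        have h0 : padicValInt p (Bf G (v j) (v j)) = 0 := by omega
        have := (padicValInt_dvd_iff 1 (Bf G (v j) (v j))).1 (by simpa using h)
        rcases this with h | h
        · exact hQ0 j h
        · omega
      · by_contra hh
        exact root_sq_ndvd hp hsf (hv j) hpp h5
          ((padicValInt_dvd_iff 2 (Bf G (v j) (v j))).2 (Or.inr (by omega)))
    · exact (padicValInt.eq_zero_of_not_dvd h).symm
  simp only [hone]

/-- A reflective lattice has four independent roots. -/
theorem exists_roots (h : ReflectiveM G) :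
    ∃ v : Fin 4 → Fin 4 → ℤ, (∀ i, IsRootM G (v i)) ∧ LinearIndependent ℤ v := by
  unfold ReflectiveM at h
  set s := {v : Fin 4 → ℤ | IsRootM G v} with hsdef
  let φ : (Fin 4 → ℤ) →ₗ[ℤ] (Fin 4 → ℚ) :=
    { toFun := fun x i => (x i : ℚ)
      map_add' := by intro x y; ext i; simp
      map_smul' := by intro c x; ext i; simp }
  have hφ : Function.Injective φ := by
    intro x y hxy
    ext i
    have := congrFun hxy i
    exact Int.cast_injective (α := ℚ) this
  let b := Module.finBasisOfFinrankEq ℤ (Submodule.span ℤ s) h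
  have hb : LinearIndependent ℤ (fun i => φ (b i : Fin 4 → ℤ)) :=
    (b.linearIndependent.map' (Submodule.subtype _) (by simp)).map' φ (LinearMap.ker_eq_bot.2 hφ)
  have hbQ : LinearIndependent ℚ (fun i => φ (b i : Fin 4 → ℤ)) :=
    (LinearIndependent.iff_fractionRing ℤ ℚ).1 hb
  have hsub : ∀ x ∈ Submodule.span ℤ s, φ x ∈ Submodule.span ℚ (φ '' s) := by
    intro x hx
    induction hx using Submodule.span_induction with
    | mem x hx => exact Submodule.subset_span ⟨x, hx, rfl⟩
    | zero => rw [map_zero]; exact Submodule.zero_mem _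
    | add x y _ _ hx hy => rw [map_add]; exact Submodule.add_mem _ hx hy
    | smul c x _ hx =>
      rw [map_smul, ← Int.cast_smul_eq_zsmul ℚ]
      exact Submodule.smul_mem _ _ hx
  have hrank : Module.finrank ℚ (Submodule.span ℚ (φ '' s)) = 4 := by
    apply le_antisymm
    · simpa using Submodule.finrank_le (Submodule.span ℚ (φ '' s))
    · have h1 : LinearIndependent ℚ (fun i => (⟨φ (b i : Fin 4 → ℤ), hsub _ (b i).2⟩ :
        Submodule.span ℚ (φ '' s))) := by
        apply LinearIndependent.of_comp (Submodule.subtype _)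
        exact hbQ
      simpa using h1.fintype_card_le_finrank
  obtain ⟨f, hf1, -, hf3⟩ := Submodule.exists_fun_fin_finrank_span_eq ℚ (φ '' s)
  choose g hg1 hg2 using hf1
  refine ⟨fun i => g (Fin.cast hrank.symm i), fun i => hg1 _, ?_⟩
  have h1 : LinearIndependent ℚ (fun i : Fin 4 => f (Fin.cast hrank.symm i)) :=
    hf3.comp _ (Fin.cast_injective _)
  have h2 := (LinearIndependent.iff_fractionRing ℤ ℚ).2 h1
  apply LinearIndependent.of_comp φ
  have h3 : (φ ∘ fun i => g (Fin.cast hrank.symm i)) = fun i => f (Fin.cast hrank.symm i) :=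
    funext fun i => hg2 _
  rw [h3]
  exact h2

end FourRootsCount

/-! ### Part 3: the neighbour construction -/

section Neighbour

variable {G : Matrix (Fin 4) (Fin 4) ℤ}

theorem Bf_transform (G N : Matrix (Fin 4) (Fin 4) ℤ) (x y : Fin 4 → ℤ) :
    Bf (Nᵀ * G * N) x y = Bf G (N.mulVec x) (N.mulVec y) := by
  unfold Bf
  rw [← mulVec_mulVec, ← mulVec_mulVec, dotProduct_mulVec, vecMul_transpose]

theorem Bf_entry (G : Matrix (Fin 4) (Fin 4) ℤ) (i j : Fin 4) :
    Bf G (Pi.single i 1) (Pi.single j 1) = G i j := by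
  rw [Bf_single, mulVec_single_one]; rfl

theorem Bf_smul_mat (k : ℤ) (G : Matrix (Fin 4) (Fin 4) ℤ) (x y : Fin 4 → ℤ) :
    Bf (k • G) x y = k * Bf G x y := by
  unfold Bf
  rw [smul_mulVec, dotProduct_smul, smul_eq_mul]

theorem genus_local {G' N T : Matrix (Fin 4) (Fin 4) ℤ} (p : ℕ) [hpf : Fact p.Prime] (k : ℤ)
    (hk : ¬ (p : ℤ) ∣ k) (h1 : N * T = (k ^ 2) • (1 : Matrix (Fin 4) (Fin 4) ℤ))
    (h2 : Nᵀ * G * N = (k ^ 2) • G') :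
    ∃ S : Matrix (Fin 4) (Fin 4) ℤ_[p], IsUnit S.det ∧
      Sᵀ * G.map (Int.cast : ℤ → ℤ_[p]) * S = G'.map (Int.cast : ℤ → ℤ_[p]) := by
  obtain ⟨t, ht⟩ : ∃ t : ℤ_[p], t * (k : ℤ_[p]) = 1 := by
    have : IsUnit (k : ℤ_[p]) := by
      rw [PadicInt.isUnit_iff]
      have h3 := PadicInt.norm_le_one (k : ℤ_[p])
      have h4 := (PadicInt.norm_int_lt_one_iff_dvd (p := p) k).not.2 hk
      exact le_antisymm h3 (not_lt.1 h4)
    obtain ⟨t, ht⟩ := this.exists_left_inv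
    exact ⟨t, ht⟩
  have ht2 : t * t * (k : ℤ_[p]) ^ 2 = 1 := by
    calc t * t * (k : ℤ_[p]) ^ 2 = (t * k) * (t * k) := by ring
      _ = 1 := by rw [ht]; ring
  have hmul : ∀ X Y : Matrix (Fin 4) (Fin 4) ℤ, (X * Y).map (Int.cast : ℤ → ℤ_[p]) =
      X.map (Int.cast : ℤ → ℤ_[p]) * Y.map (Int.cast : ℤ → ℤ_[p]) := fun X Y =>
    Matrix.map_mul (f := Int.castRingHom ℤ_[p])
  have hsm : ∀ (c : ℤ) (X : Matrix (Fin 4) (Fin 4) ℤ), (c • X).map (Int.cast : ℤ → ℤ_[p]) =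
      (c : ℤ_[p]) • X.map (Int.cast : ℤ → ℤ_[p]) := by
    intro c X; ext i j
    simp only [map_apply, Matrix.smul_apply, smul_eq_mul, Int.cast_mul]
  have h1' := congrArg (fun X => X.map (Int.cast : ℤ → ℤ_[p])) h1
  have h2' := congrArg (fun X => X.map (Int.cast : ℤ → ℤ_[p])) h2
  simp only [hmul, hsm] at h1' h2'
  refine ⟨t • N.map (Int.cast : ℤ → ℤ_[p]), ?_, ?_⟩
  · apply Matrix.isUnit_det_of_right_inverse (B := t • T.map (Int.cast : ℤ → ℤ_[p]))
    rw [smul_mul_smul_comm, h1', smul_smul]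
    push_cast
    rw [ht2, one_smul, Matrix.map_one _ Int.cast_zero Int.cast_one]
  · rw [transpose_smul, smul_mul_assoc, smul_mul_smul_comm, transpose_map] at *
    rw [h2', smul_smul]
    push_cast
    rw [ht2, one_smul]

theorem neighbour (hs : G.IsSymm) (hp : PosDefM G) {l : ℕ} (hl : l.Prime) (h5 : 5 ≤ l)
    (w : Fin 4 → ℤ) (hw : (l : ℤ) ^ 2 ∣ Bf G w w) (y : Fin 4 → ℤ) (hy : ¬ (l : ℤ) ∣ Bf G y w) :
    ∃ B G' : Matrix (Fin 4) (Fin 4) ℤ, G'.IsSymm ∧ PosDefM G' ∧ SameGenusM G G' ∧ B.det ≠ 0 ∧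
      (∀ x y, Bf G (B.mulVec x) (B.mulVec y) = (l : ℤ) ^ 2 * Bf G' x y) ∧
      (∀ u, (∃ x, B.mulVec x = u) ↔ ∃ (c : ℤ) (z : Fin 4 → ℤ), u = c • w + (l : ℤ) • z ∧
        (l : ℤ) ∣ Bf G z w) := by
  have hprime := Nat.prime_iff_prime_int.mp hl
  have hl0 : (l : ℤ) ≠ 0 := hprime.ne_zero
  let M : Submodule ℤ (Fin 4 → ℤ) :=
    { carrier := {u | ∃ (c : ℤ) (z : Fin 4 → ℤ), u = c • w + (l : ℤ) • z ∧ (l : ℤ) ∣ Bf G z w}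
      zero_mem' := ⟨0, 0, by simp, by rw [Bf_zero_left]; exact dvd_zero _⟩
      add_mem' := by
        rintro _ _ ⟨c, z, rfl, h⟩ ⟨c', z', rfl, h'⟩
        exact ⟨c + c', z + z', by rw [add_smul, smul_add]; abel, by
          rw [Bf_add_left]; exact dvd_add h h'⟩
      smul_mem' := by
        rintro k _ ⟨c, z, rfl, h⟩
        exact ⟨k * c, k • z, by rw [smul_add, mul_smul, smul_comm k (l : ℤ) z], by
          rw [Bf_smul_left]; exact h.mul_left _⟩ }
  have hM : ∀ u, u ∈ M ↔ ∃ (c : ℤ) (z : Fin 4 → ℤ), u = c • w + (l : ℤ) • z ∧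
      (l : ℤ) ∣ Bf G z w := fun u => Iff.rfl
  have hM2 : ∀ z : Fin 4 → ℤ, ((l : ℤ) ^ 2) • z ∈ M := by
    intro z
    refine (hM _).2 ⟨0, (l : ℤ) • z, ?_, ?_⟩
    · rw [zero_smul, zero_add, smul_smul, sq]
    · rw [Bf_smul_left]; exact dvd_mul_right _ _
  have hrank : Module.finrank ℤ M = 4 := by
    apply le_antisymm
    · simpa using Submodule.finrank_le M
    · have h1 : LinearIndependent ℤ (fun i : Fin 4 => (⟨_, hM2 (Pi.single i 1)⟩ : M)) := by
        rw [Fintype.linearIndependent_iff]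
        intro g hg i
        have h2 := congrArg (fun m : M => (m : Fin 4 → ℤ) i) hg
        simp [Finset.sum_apply, Pi.single_apply] at h2
        rcases h2 with h2 | h2
        · exact h2
        · exact absurd h2 (by exact_mod_cast hl0)
      simpa using h1.fintype_card_le_finrank
  let b := Module.finBasisOfFinrankEq ℤ M hrank
  let B : Matrix (Fin 4) (Fin 4) ℤ := Matrix.of fun i j => (b j : Fin 4 → ℤ) i
  have hBx : ∀ x, B.mulVec x = ((∑ j, x j • b j : M) : Fin 4 → ℤ) := by
    intro x
    ext i
    simp [B, mulVec, dotProduct, Finset.sum_apply, mul_comm]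
  have hBM : ∀ u, (∃ x, B.mulVec x = u) ↔ u ∈ M := by
    intro u
    constructor
    · rintro ⟨x, rfl⟩; rw [hBx]; exact (∑ j, x j • b j : M).2
    · intro hu
      refine ⟨b.repr ⟨u, hu⟩, ?_⟩
      rw [hBx, b.sum_repr]
  have hcol : ∀ X : Matrix (Fin 4) (Fin 4) ℤ, (∀ z, X.mulVec z ∈ M) → ∃ T, B * T = X := by
    intro X hX
    choose f hf using fun j => (hBM _).2 (hX (Pi.single j 1))
    refine ⟨Matrix.of fun i j => f j i, ?_⟩
    ext i j
    have := congrFun (hf j) i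
    rw [mulVec_single_one] at this
    exact this
  obtain ⟨C, hC⟩ := hcol (((l : ℤ) ^ 2) • 1) (by
    intro z; rw [smul_mulVec, one_mulVec]; exact hM2 z)
  have hBdet : B.det ≠ 0 := by
    intro h0
    have := congrArg Matrix.det hC
    rw [det_mul, h0, zero_mul, det_smul, det_one, mul_one] at this
    exact (pow_ne_zero _ (pow_ne_zero _ hl0)) this.symm
  have hMM : ∀ u ∈ M, ∀ u' ∈ M, (l : ℤ) ^ 2 ∣ Bf G u u' := by
    rintro _ ⟨c, z, rfl, h⟩ _ ⟨c', z', rfl, h'⟩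
    simp only [Bf_add_left, Bf_add_right, Bf_smul_left, Bf_smul_right, Bf_comm hs w z']
    obtain ⟨t, ht⟩ := h
    obtain ⟨t', ht'⟩ := h'
    obtain ⟨s, hs'⟩ := hw
    rw [ht, ht', hs']
    exact ⟨c * c' * s + c * t' + c' * t + Bf G z z', by ring⟩
  have hG' : ∀ i j, ∃ g, Bf G (b i : Fin 4 → ℤ) (b j : Fin 4 → ℤ) = (l : ℤ) ^ 2 * g :=
    fun i j => hMM _ (b i).2 _ (b j).2
  choose G0 hG0 using hG'
  let G' : Matrix (Fin 4) (Fin 4) ℤ := Matrix.of G0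
  have hBG : Bᵀ * G * B = ((l : ℤ) ^ 2) • G' := by
    ext i j
    rw [← Bf_entry (Bᵀ * G * B), Bf_transform, mulVec_single_one, mulVec_single_one,
      Matrix.smul_apply, smul_eq_mul]
    exact hG0 i j
  have hBf : ∀ x y, Bf G (B.mulVec x) (B.mulVec y) = (l : ℤ) ^ 2 * Bf G' x y := by
    intro x y
    rw [← Bf_transform, hBG, Bf_smul_mat]
  have hl2 : (0 : ℤ) < (l : ℤ) ^ 2 := by positivity
  refine ⟨B, G', ?_, ?_, ?_, hBdet, hBf, hBM⟩
  · ext i j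
    have := hG0 i j
    rw [Bf_comm hs, hG0 j i] at this
    exact mul_left_cancel₀ hl2.ne' this
  · intro x hx
    have h1 : B.mulVec x ≠ 0 := by
      intro h0
      exact hx (Matrix.eq_zero_of_mulVec_eq_zero hBdet h0)
    have h2 := hp _ h1
    rw [hBf] at h2
    exact (pos_iff_pos_of_mul_pos h2).1 hl2
  · intro p hpf
    by_cases hpl : p = l
    · subst hpl
      obtain ⟨s, hs'⟩ := hw
      obtain ⟨x, hx⟩ : ∃ x, x = w + (p : ℤ) • y := ⟨_, rfl⟩
      obtain ⟨e, he⟩ : ∃ e, e = p * s + 2 * Bf G y w + p * Bf G y y := ⟨_, rfl⟩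
      have hQx : Bf G x x = p * e := by
        rw [hx, he]
        simp only [Bf_add_left, Bf_add_right, Bf_smul_left, Bf_smul_right, Bf_comm hs w y, hs']
        ring
      have hpe : ¬ (p : ℤ) ∣ e := by
        intro h
        have h1 : (p : ℤ) ∣ 2 * Bf G y w := by
          have : 2 * Bf G y w = e - p * (s + Bf G y y) := by rw [he]; ring
          rw [this]; exact dvd_sub h (dvd_mul_right _ _)
        rcases hprime.dvd_or_dvd h1 with h | h
        · have := Int.le_of_dvd (by norm_num) h
          omega
        · exact hy h
      let f : (Fin 4 → ℤ) →ₗ[ℤ] (Fin 4 → ℤ) :=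
        { toFun := fun z => Bf G x x • z - (2 * Bf G z x) • x
          map_add' := by intro z z'; rw [Bf_add_left]; simp only [mul_add, add_smul, smul_add]; abel
          map_smul' := by
            intro c z
            rw [Bf_smul_left]
            simp only [RingHom.id_apply, smul_sub, smul_smul]
            congr 2 <;> ring }
      let R := LinearMap.toMatrix' f
      have hR : ∀ z, R.mulVec z = Bf G x x • z - (2 * Bf G z x) • x := by
        intro z
        rw [← Matrix.toLin'_apply, Matrix.toLin'_toMatrix']
        rfl
      have hRR : R * R = ((p : ℤ) ^ 2 * e ^ 2) • (1 : Matrix (Fin 4) (Fin 4) ℤ) := by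
        apply Matrix.ext_of_mulVec_single
        intro i
        rw [← mulVec_mulVec, hR, hR, smul_mulVec, one_mulVec]
        simp only [Bf_sub_left, Bf_smul_left, smul_sub, smul_smul]
        generalize (Pi.single i 1 : Fin 4 → ℤ) = z
        ext k
        simp only [Pi.sub_apply, Pi.smul_apply, smul_eq_mul, hQx]
        ring
      have hRiso : ∀ z z', Bf G (R.mulVec z) (R.mulVec z') = ((p : ℤ) ^ 2 * e ^ 2) * Bf G z z' := by
        intro z z'
        rw [hR, hR]
        simp only [Bf_sub_left, Bf_sub_right, Bf_smul_left, Bf_smul_right, hQx, Bf_comm hs x z']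
        ring
      obtain ⟨T, hT⟩ := hcol R (by
        intro z
        rw [hR]
        refine (hM _).2 ⟨-(2 * Bf G z x), e • z - (2 * Bf G z x) • y, ?_, ?_⟩
        · rw [hQx]
          nth_rewrite 2 [hx]
          ext k
          simp only [Pi.sub_apply, Pi.add_apply, Pi.smul_apply, smul_eq_mul]
          ring
        · rw [Bf_sub_left, Bf_smul_left, Bf_smul_left, he, hx]
          simp only [Bf_add_right, Bf_smul_right]
          exact ⟨(s + Bf G y y) * Bf G z w - 2 * Bf G z y * Bf G y w, by ring⟩)
      have hRM : ∀ u ∈ M, ∃ n, R.mulVec u = ((p : ℤ) ^ 2) • n := by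
        rintro _ ⟨c, z, rfl, ⟨t, ht⟩⟩
        rw [hR, hQx]
        refine ⟨(c * (Bf G y y - s)) • w - (2 * c * (p * s + Bf G y w)) • y
          + e • z - (2 * (t + Bf G z y)) • x, ?_⟩
        rw [he, hx]
        simp only [Bf_add_left, Bf_add_right, Bf_smul_left, Bf_smul_right, ht, hs', Bf_comm hs w y]
        ext k
        simp only [Pi.sub_apply, Pi.add_apply, Pi.smul_apply, smul_eq_mul]
        ring
      choose n hn using fun j => hRM (b j : Fin 4 → ℤ) (b j).2
      let N : Matrix (Fin 4) (Fin 4) ℤ := Matrix.of fun i j => n j i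
      have hN : R * B = ((p : ℤ) ^ 2) • N := by
        ext i j
        exact congrFun (hn j) i
      apply genus_local p e hpe (N := N) (T := T)
      · have h1 : ((p : ℤ) ^ 2) • (N * T) = ((p : ℤ) ^ 2) • (e ^ 2 • (1 : Matrix (Fin 4) (Fin 4) ℤ)) := by
          rw [← smul_mul_assoc, ← hN, mul_assoc, hT, hRR, smul_smul]
        exact smul_right_injective _ hl2.ne' h1
      · ext i j
        rw [← Bf_entry (Nᵀ * G * N), Bf_transform, Matrix.smul_apply, smul_eq_mul,
          ← Bf_entry G' i j]
        generalize (Pi.single i 1 : Fin 4 → ℤ) = z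
        generalize (Pi.single j 1 : Fin 4 → ℤ) = z'
        have h1 : ∀ z, ((p : ℤ) ^ 2) • N.mulVec z = R.mulVec (B.mulVec z) := by
          intro z; rw [mulVec_mulVec, hN, smul_mulVec]
        have h2 := hRiso (B.mulVec z) (B.mulVec z')
        rw [← h1, ← h1, Bf_smul_left, Bf_smul_right, hBf] at h2
        have h4 : ((p : ℤ) ^ 2 * (p : ℤ) ^ 2) ≠ 0 := by positivity
        apply mul_left_cancel₀ h4
        linarith
    · exact genus_local p l (by
        intro h
        have h1 := Int.natCast_dvd_natCast.1 h
        exact hpl ((Nat.prime_dvd_prime_iff_eq hpf.out hl).1 h1)) hC hBG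

end Neighbour

/-! ### Part 4: roots of the neighbour -/

section NeighbourRoots

variable {G : Matrix (Fin 4) (Fin 4) ℤ}

/-- A linear functional that vanishes modulo `l` where `b(·, w)` does is a multiple of it. -/
theorem functional_dvd {l : ℕ} (hl : l.Prime) (w y : Fin 4 → ℤ) (hy : ¬ (l : ℤ) ∣ Bf G y w)
    (m : ℤ) (f : (Fin 4 → ℤ) → ℤ) (hf : ∀ x z c, f (x - c • z) = f x - c * f z)
    (h : ∀ x, (l : ℤ) ∣ Bf G x w → m ∣ f x) :
    ∃ κ, ∀ x, m ∣ f x - κ * Bf G x w := by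
  have hprime := Nat.prime_iff_prime_int.mp hl
  obtain ⟨s, t, hst⟩ := (Prime.coprime_iff_not_dvd hprime).2 hy
  refine ⟨t * f y, fun x => ?_⟩
  have h1 := h (x - (t * Bf G x w) • y) (by
    rw [Bf_sub_left, Bf_smul_left]
    exact ⟨Bf G x w * s, by linear_combination (-Bf G x w) * hst⟩)
  rw [hf] at h1
  have : f x - t * f y * Bf G x w = f x - t * Bf G x w * f y := by ring
  rwa [this]

theorem neighbour_contra (hs : G.IsSymm) (hp : PosDefM G) (hsf : SquareFreeM G)
    (htr : TotallyReflectiveM G) {l : ℕ} (hl : l.Prime) (h5 : 5 ≤ l)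
    (w v4 : Fin 4 → ℤ) (c4 : ℤ) (hw : (l : ℤ) ^ 2 ∣ Bf G w w) (hv4 : RL G v4)
    (hc4 : ¬ (l : ℤ) ∣ c4) (hnd : ∃ y, ¬ (l : ℤ) ∣ Bf G y w)
    (hS : ∀ (u : Fin 4 → ℤ) (n κ : ℤ), 0 < n → Bf G u u ≤ (l : ℤ) ^ 2 * n →
      (∀ x, n ∣ 2 * Bf G x u) → ¬ (l : ℤ) ∣ κ → (∀ x, (l : ℤ) ∣ Bf G x u - κ * Bf G x w) →
      Bf G u v4 ≠ 0 → False)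
    (hO : ∀ v, RL G v → Bf G v v4 ≠ 0 → Bf G v w = c4 * Bf G v v4) : False := by
  obtain ⟨y, hy⟩ := hnd
  obtain ⟨B, G', hs', hp', hgen, hBdet, hBf, hBM⟩ := neighbour hs hp hl h5 w hw y hy
  obtain ⟨r, hr, hrli⟩ := exists_roots (htr G' hs' hp' hgen)
  have hprime := Nat.prime_iff_prime_int.mp hl
  have hl0 : (l : ℤ) ≠ 0 := hprime.ne_zero
  have hlpos : (0 : ℤ) < l := by omega
  have hl2 : (0 : ℤ) < (l : ℤ) ^ 2 := by positivity
  have hn2 : ¬ (l : ℤ) ∣ 2 := by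
    intro h; have := Int.le_of_dvd (by norm_num) h; omega
  have hc2 : IsCoprime (l : ℤ) 2 := (Prime.coprime_iff_not_dvd hprime).2 hn2
  have key : ∀ i, Bf G (B.mulVec (r i)) v4 = 0 := by
    intro i
    by_contra hne
    have hroot := root_RL hp' (hr i)
    have hprim := (hr i).2.1
    generalize hv' : r i = v' at *
    obtain ⟨u, hu⟩ : ∃ u, u = B.mulVec v' := ⟨_, rfl⟩
    obtain ⟨n, hn⟩ : ∃ n, n = Bf G' v' v' := ⟨_, rfl⟩
    have hQu : Bf G u u = (l : ℤ) ^ 2 * n := by rw [hu, hn, hBf]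
    rw [← hu] at hne
    obtain ⟨hnpos, hnd⟩ := hroot
    rw [← hn] at hnpos hnd
    have hMd : ∀ (c : ℤ) (z : Fin 4 → ℤ), (l : ℤ) ∣ Bf G z w →
        (l : ℤ) ^ 2 * n ∣ 2 * Bf G (c • w + (l : ℤ) • z) u := by
      intro c z hz
      obtain ⟨x, hx⟩ := (hBM (c • w + (l : ℤ) • z)).2 ⟨c, z, rfl, hz⟩
      rw [← hx, hu, hBf]
      obtain ⟨t, ht⟩ := hnd x
      exact ⟨t, by linear_combination (l : ℤ) ^ 2 * ht⟩
    have hall : ∀ x, n ∣ 2 * Bf G x u := by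
      intro x
      have := hMd 0 ((l : ℤ) • x) (by rw [Bf_smul_left]; exact dvd_mul_right _ _)
      rw [zero_smul, zero_add, Bf_smul_left, Bf_smul_left] at this
      have h2 : (l : ℤ) ^ 2 * n ∣ (l : ℤ) ^ 2 * (2 * Bf G x u) := by
        convert this using 1; ring
      exact Int.dvd_of_mul_dvd_mul_left hl2.ne' h2
    obtain ⟨c, z, huz, hz⟩ := (hBM u).1 ⟨v', hu.symm⟩
    by_cases hc : (l : ℤ) ∣ c
    · obtain ⟨c1, rfl⟩ := hc
      obtain ⟨v, hv⟩ : ∃ v, v = c1 • w + z := ⟨_, rfl⟩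
      have huv : u = (l : ℤ) • v := by rw [huz, hv, smul_add, smul_smul]
      have hQv : Bf G v v = n := by
        rw [huv, Bf_smul_left, Bf_smul_right] at hQu
        apply mul_left_cancel₀ hl2.ne'
        linarith
      have hne' : Bf G v v4 ≠ 0 := by
        intro h0; rw [huv, Bf_smul_left, h0, mul_zero] at hne; exact hne rfl
      have hwv : (l : ℤ) * n ∣ 2 * Bf G w v := by
        have := hMd 1 0 (by rw [Bf_zero_left]; exact dvd_zero _)
        rw [one_smul, smul_zero, add_zero, huv, Bf_smul_right] at this
        have h2 : (l : ℤ) * (l * n) ∣ l * (2 * Bf G w v) := by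
          convert this using 1 <;> ring
        exact Int.dvd_of_mul_dvd_mul_left hl0 h2
      have hH : ∀ x, (l : ℤ) ∣ Bf G x w → n ∣ 2 * Bf G x v := by
        intro x hx
        have := hMd 0 x hx
        rw [zero_smul, zero_add, huv, Bf_smul_right, Bf_smul_left] at this
        have h2 : (l : ℤ) ^ 2 * n ∣ (l : ℤ) ^ 2 * (2 * Bf G x v) := by
          convert this using 1; ring
        exact Int.dvd_of_mul_dvd_mul_left hl2.ne' h2
      have hallv : ∀ x, n ∣ l * (2 * Bf G x v) := by
        intro x
        have := hall x
        rw [huv, Bf_smul_right] at this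
        convert this using 1; ring
      have hRLv : ∀ x, n ∣ 2 * Bf G x v := by
        by_cases hln : (l : ℤ) ∣ n
        · obtain ⟨n1, hn1⟩ := hln
          have hn1pos : 0 < n1 := by
            rw [hn1] at hnpos; exact (pos_iff_pos_of_mul_pos hnpos).1 hlpos
          have hn1d : ∀ x, n1 ∣ 2 * Bf G x v := by
            intro x
            have := hallv x
            rw [hn1] at this
            exact Int.dvd_of_mul_dvd_mul_left hl0 this
          have hf0 : ∀ x z c, Bf G (x - c • z) v = Bf G x v - c * Bf G z v := by
            intro x z c; rw [Bf_sub_left, Bf_smul_left]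
          obtain ⟨κ, hκ⟩ := functional_dvd hl w y hy l (fun x => Bf G x v) hf0 (by
            intro x hx
            have h1 : (l : ℤ) ∣ 2 * Bf G x v := (by rw [hn1]; exact dvd_mul_right _ _ :
              (l : ℤ) ∣ n).trans (hH x hx)
            exact (hprime.dvd_or_dvd h1).resolve_left hn2)
          have hlκ : (l : ℤ) ∣ κ := by
            by_contra hk
            refine hS v n1 κ hn1pos ?_ hn1d hk hκ hne'
            rw [hQv, hn1]
            nlinarith [mul_pos hlpos hn1pos]
          have hlall : ∀ x, (l : ℤ) ∣ Bf G x v := by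
            intro x
            have := dvd_add (hκ x) (hlκ.mul_right (Bf G x w))
            simpa using this
          by_cases hln1 : (l : ℤ) ∣ n1
          · exfalso
            choose g hg using hlall
            have hgf : ∀ x z c, g (x - c • z) = g x - c * g z := by
              intro x z c
              apply mul_left_cancel₀ hl0
              rw [← hg, hf0, hg, hg]; ring
            have hl2n : (l : ℤ) ^ 2 ∣ n := by
              rw [hn1, sq]; exact mul_dvd_mul_left _ hln1
            obtain ⟨κ', hκ'⟩ := functional_dvd hl w y hy l g hgf (by
              intro x hx
              have h1 : (l : ℤ) ^ 2 ∣ Bf G x v :=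
                (hc2.pow_left).dvd_of_dvd_mul_left (hl2n.trans (hH x hx))
              rw [hg, sq] at h1
              exact Int.dvd_of_mul_dvd_mul_left hl0 h1)
            have hd := sf_dvd hsf hl (v - ((l : ℤ) * κ') • w) (by
              intro i
              rw [← Bf_single, Bf_sub_right, Bf_smul_right, hg]
              obtain ⟨t, ht⟩ := hκ' (Pi.single i 1)
              exact ⟨t, by linear_combination (l : ℤ) * ht⟩)
            choose y' hy' using hd
            have hv1 : v = (l : ℤ) • (κ' • w + y') := by
              ext k
              have := hy' k
              simp only [Pi.sub_apply, Pi.add_apply, Pi.smul_apply, smul_eq_mul] at this ⊢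
              linarith
            have hlw : (l : ℤ) ∣ Bf G (κ' • w + y') w := by
              rw [hv1, Bf_smul_right] at hwv
              have h2 : (l : ℤ) * n ∣ l * (2 * Bf G w (κ' • w + y')) := by
                convert hwv using 1; ring
              have h3 := Int.dvd_of_mul_dvd_mul_left hl0 h2
              rw [Bf_comm hs] at h3
              have h4 : (l : ℤ) ∣ 2 * Bf G (κ' • w + y') w :=
                (by rw [hn1]; exact dvd_mul_right _ _ : (l : ℤ) ∣ n).trans h3
              exact (hprime.dvd_or_dvd h4).resolve_left hn2
            obtain ⟨x1, hx1⟩ := (hBM ((0 : ℤ) • w + (l : ℤ) • (κ' • w + y'))).2 ⟨0, _, rfl, hlw⟩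
            rw [zero_smul, zero_add, ← hv1] at hx1
            have h6 : B.mulVec ((l : ℤ) • x1 - v') = 0 := by
              rw [mulVec_sub, mulVec_smul, hx1, ← hu, huv, sub_self]
            have h7 := Matrix.eq_zero_of_mulVec_eq_zero hBdet h6
            exact hprim l (by omega) ⟨x1, sub_eq_zero.1 h7⟩
          · intro x
            rw [hn1]
            exact ((Prime.coprime_iff_not_dvd hprime).2 hln1).mul_dvd ((hlall x).mul_left _) (hn1d x)
        · intro x
          exact ((Prime.coprime_iff_not_dvd hprime).2 hln).symm.dvd_of_dvd_mul_left (hallv x)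
      have hvRL : RL G v := ⟨by rw [hQv]; exact hnpos, fun x => by rw [hQv]; exact hRLv x⟩
      have hO' := hO v hvRL hne'
      obtain ⟨a, ha⟩ := hRLv v4
      obtain ⟨a', ha'⟩ := hv4.2 v
      rw [Bf_comm hs v4 v] at ha
      have hle : |a| ≤ 4 := entry_le (b := Bf G v v4) (a := a) (a' := a') hv4.1 hvRL.1 (by rw [hQv, ha]; ring)
        (by rw [ha']; ring) (by
          rw [Bf_comm hs v v4]; exact Bf_cs hs hp v4 v hvRL.1)
      have ha0 : a ≠ 0 := by rintro rfl; apply hne'; linarith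
      have hla : (l : ℤ) ∣ a := by
        rw [Bf_comm hs, hO'] at hwv
        have h1 : n * (l : ℤ) ∣ n * (c4 * a) := by
          convert hwv using 1
          · ring
          · linear_combination (-c4) * ha
        have h2 := Int.dvd_of_mul_dvd_mul_left hnpos.ne' h1
        exact (hprime.dvd_or_dvd h2).resolve_left hc4
      have h8 := Int.le_of_dvd (abs_pos.2 ha0) ((dvd_abs _ _).2 hla)
      omega
    · refine hS u n c hnpos hQu.le hall hc ?_ hne
      intro x
      rw [huz, Bf_add_right, Bf_smul_right, Bf_smul_right]
      exact ⟨Bf G x z, by ring⟩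
  have hVdet : (Matrix.of r : Matrix (Fin 4) (Fin 4) ℤ).det ≠ 0 := by
    intro h0
    obtain ⟨c, hc0, hc⟩ := Matrix.exists_vecMul_eq_zero_iff.2 h0
    apply hc0
    rw [Fintype.linearIndependent_iff] at hrli
    ext i
    refine hrli c ?_ i
    rw [← hc]
    ext l
    simp [vecMul, dotProduct]
  have h1 : (Matrix.of r : Matrix (Fin 4) (Fin 4) ℤ).mulVec (Bᵀ.mulVec (G.mulVec v4)) = 0 := by
    ext i
    have h2 := key i
    unfold Bf at h2
    rw [← vecMul_transpose, ← dotProduct_mulVec] at h2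
    exact h2
  have h2 := Matrix.eq_zero_of_mulVec_eq_zero hVdet h1
  have h3 := Matrix.eq_zero_of_mulVec_eq_zero (by rwa [det_transpose]) h2
  have h4 := hv4.1
  unfold Bf at h4
  rw [h3, dotProduct_zero] at h4
  exact lt_irrefl _ h4

end NeighbourRoots

/-! ### Part 5: the size estimate -/

section Size

variable {G : Matrix (Fin 4) (Fin 4) ℤ}

theorem size_one {n N b : ℤ} (hn : 0 < n) (hN : 0 < N) (h1 : n ∣ 2 * b) (h2 : N ∣ 2 * b)
    (hb : b ≠ 0) : ∃ δ : ℤ, 0 < δ ∧ n * N * δ ≤ 4 * b ^ 2 ∧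
      ∀ p : ℕ, p.Prime → ¬ ((p : ℤ) ∣ n ↔ (p : ℤ) ∣ N) → (p : ℤ) ∣ δ := by
  have hg : (0 : ℤ) < Int.gcd n N := by
    have : Int.gcd n N ≠ 0 := by
      intro h0; rw [Int.gcd_eq_zero_iff] at h0; omega
    positivity
  obtain ⟨a, ha⟩ := Int.gcd_dvd_left n N
  obtain ⟨a', ha'⟩ := Int.gcd_dvd_right n N
  have hl : (Int.lcm n N : ℤ) ∣ 2 * b := Int.coe_lcm_dvd h1 h2
  have hgl : (Int.gcd n N : ℤ) * Int.lcm n N = n * N := by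
    have := Int.gcd_mul_lcm n N
    have h3 : ((Int.gcd n N * Int.lcm n N : ℕ) : ℤ) = ((n * N).natAbs : ℤ) := by
      rw [this, Int.natAbs_mul]
    rw [Int.natAbs_of_nonneg (by positivity)] at h3
    exact_mod_cast h3
  generalize (Int.gcd n N : ℤ) = g at *
  generalize (Int.lcm n N : ℤ) = l at *
  have hapos : 0 < a := by by_contra hh; nlinarith
  have hapos' : 0 < a' := by by_contra hh; nlinarith
  have hl' : l = g * (a * a') := by
    have : g * l = g * (g * (a * a')) := by rw [hgl, ha, ha']; ring
    exact mul_left_cancel₀ hg.ne' this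
  refine ⟨a * a', by positivity, ?_, ?_⟩
  · obtain ⟨c, hc⟩ := hl
    have hcne : c ≠ 0 := by rintro rfl; apply hb; omega
    have hc1 : 1 ≤ c ^ 2 := by
      have : 0 < c ^ 2 := by positivity
      omega
    have hbb : 4 * b ^ 2 = l ^ 2 * c ^ 2 := by rw [← mul_pow, ← hc]; ring
    have h5 : n * N * (a * a') = l ^ 2 := by rw [hl', ha, ha']; ring
    rw [h5, hbb]
    nlinarith [sq_nonneg l]
  · intro p hp hnot
    have hprime := Nat.prime_iff_prime_int.mp hp
    by_cases h : (p : ℤ) ∣ n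
    · have h' : ¬ (p : ℤ) ∣ N := fun h' => hnot ⟨fun _ => h', fun _ => h⟩
      rw [ha] at h
      rcases hprime.dvd_or_dvd h with h | h
      · exact absurd (ha' ▸ h.mul_right a') h'
      · exact h.mul_right _
    · have h' : (p : ℤ) ∣ N := by
        by_contra h'; exact hnot ⟨fun h0 => absurd h0 h, fun h0 => absurd h0 h'⟩
      rw [ha'] at h'
      rcases hprime.dvd_or_dvd h' with h1 | h1
      · exact absurd (ha ▸ h1.mul_right a) h
      · exact h1.mul_left _

theorem bessel_size (hs : G.IsSymm) (hp : PosDefM G) {k : ℕ} (r : Fin k → Fin 4 → ℤ)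
    (hr : ∀ i, 0 < Bf G (r i) (r i)) (horth : ∀ i j, i ≠ j → Bf G (r i) (r j) = 0)
    (u : Fin 4 → ℤ) (n : ℤ) (δ : Fin k → ℤ)
    (h : ∀ i, n * Bf G (r i) (r i) * δ i ≤ 4 * Bf G u (r i) ^ 2) :
    n * ∑ i, δ i ≤ 4 * Bf G u u := by
  obtain ⟨K, hK⟩ : ∃ K, K = ∏ i, Bf G (r i) (r i) := ⟨_, rfl⟩
  have hKpos : 0 < K := by rw [hK]; exact Finset.prod_pos fun i _ => hr i
  have hdiv : ∀ i, ∃ m, K = Bf G (r i) (r i) * m := by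
    intro i; rw [hK]; exact Finset.dvd_prod_of_mem _ (Finset.mem_univ i)
  choose m hm using hdiv
  have hmpos : ∀ i, 0 < m i := by
    intro i
    have := hm i
    have h2 := hr i
    rw [this] at hKpos
    exact (pos_iff_pos_of_mul_pos hKpos).1 h2
  have hnn := Bf_nonneg hp (K • u - ∑ i, (m i * Bf G u (r i)) • r i)
  have e1 : ∀ z, Bf G (∑ i, (m i * Bf G u (r i)) • r i) z
      = ∑ i, m i * Bf G u (r i) * Bf G (r i) z := by
    intro z; rw [Bf_sum_left]; simp only [Bf_smul_left]
  have e2 : ∀ j, Bf G (∑ i, (m i * Bf G u (r i)) • r i) (r j) = K * Bf G u (r j) := by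
    intro j
    rw [e1, Finset.sum_eq_single j]
    · rw [hm j]; ring
    · intro i _ hij; rw [horth i j hij, mul_zero]
    · intro h; exact absurd (Finset.mem_univ j) h
  have e3 : Bf G (∑ i, (m i * Bf G u (r i)) • r i) u = ∑ i, m i * Bf G u (r i) ^ 2 := by
    rw [e1]
    refine Finset.sum_congr rfl fun i _ => ?_
    rw [Bf_comm hs (r i) u]; ring
  have e4 : Bf G (∑ i, (m i * Bf G u (r i)) • r i) (∑ i, (m i * Bf G u (r i)) • r i)
      = K * ∑ i, m i * Bf G u (r i) ^ 2 := by
    rw [e1, Finset.mul_sum]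
    refine Finset.sum_congr rfl fun i _ => ?_
    rw [Bf_comm hs (r i) (∑ i, (m i * Bf G u (r i)) • r i), e2]; ring
  rw [Bf_sub_left, Bf_sub_right, Bf_sub_right, e4, Bf_smul_left, Bf_smul_right, Bf_smul_left,
    Bf_smul_right, Bf_comm hs u (∑ i, (m i * Bf G u (r i)) • r i), e3] at hnn
  have h1 : ∑ i, m i * Bf G u (r i) ^ 2 ≤ K * Bf G u u := by
    have : 0 ≤ K * (K * Bf G u u - ∑ i, m i * Bf G u (r i) ^ 2) := by linarith
    have := nonneg_of_mul_nonneg_right this hKpos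
    linarith
  have h2 : K * (n * ∑ i, δ i) ≤ 4 * ∑ i, m i * Bf G u (r i) ^ 2 := by
    rw [Finset.mul_sum, Finset.mul_sum, Finset.mul_sum]
    refine Finset.sum_le_sum fun i _ => ?_
    have := mul_le_mul_of_nonneg_left (h i) (hmpos i).le
    rw [hm i]
    linarith
  have h3 : K * (n * ∑ i, δ i) ≤ K * (4 * Bf G u u) := by linarith
  exact le_of_mul_le_mul_left h3 hKpos

/-- The core contradiction, given a suitable neighbour vector `w = z + c₄ v₄` and orthogonal
representatives `r i` of the classes of roots. -/
theorem core (hs : G.IsSymm) (hp : PosDefM G) (hsf : SquareFreeM G)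
    (htr : TotallyReflectiveM G) {l : ℕ} (hl : l.Prime) (h5 : 5 ≤ l)
    {k : ℕ} (r : Fin k → Fin 4 → ℤ) (hr : ∀ i, RL G (r i))
    (horth : ∀ i j, i ≠ j → Bf G (r i) (r j) = 0) (i4 : Fin k) (i1 : Fin k) (hi1 : i1 ≠ i4)
    (w z : Fin 4 → ℤ) (c4 : ℤ) (hc4 : ¬ (l : ℤ) ∣ c4) (hwz : w = z + c4 • r i4)
    (hw : (l : ℤ) ^ 2 ∣ Bf G w w)
    (hz : ∀ v, RL G v → Bf G v (r i4) ≠ 0 → Bf G v z = 0)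
    (hnd : ∀ i, i ≠ i4 → ¬ (l : ℤ) ∣ Bf G (r i) w)
    (hsize : ∀ (n : ℤ) (δ : Fin k → ℤ), (∀ i, 0 < δ i) → ∑ i, δ i ≤ 4 * (l : ℤ) ^ 2 →
      (∀ (p : ℕ) (i : Fin k), p.Prime → ¬ ((p : ℤ) ∣ n ↔ (p : ℤ) ∣ Bf G (r i) (r i)) →
        (p : ℤ) ∣ δ i) → False) : False := by
  have hprime := Nat.prime_iff_prime_int.mp hl
  refine neighbour_contra hs hp hsf htr hl h5 w (r i4) c4 hw (hr i4) hc4 ⟨_, hnd i1 hi1⟩ ?_ ?_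
  · intro u n κ hn hQ hdiv hκ hcong hne
    have hne' : ∀ i, Bf G u (r i) ≠ 0 := by
      intro i
      by_cases hi : i = i4
      · subst hi; exact hne
      · intro h0
        have h1 := hcong (r i)
        rw [Bf_comm hs, h0, zero_sub, dvd_neg] at h1
        exact (hprime.dvd_or_dvd h1).elim hκ (hnd i hi)
    choose δ hδ1 hδ2 hδ3 using fun i => size_one hn (hr i).1
      (by rw [Bf_comm hs]; exact hdiv (r i) : n ∣ 2 * Bf G u (r i)) ((hr i).2 u) (hne' i)
    refine hsize n δ hδ1 ?_ (fun p i => hδ3 i p)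
    have h1 := bessel_size hs hp r (fun i => (hr i).1) horth u n δ hδ2
    have h2 : n * ∑ i, δ i ≤ n * (4 * (l : ℤ) ^ 2) := by linarith
    exact le_of_mul_le_mul_left h2 hn
  · intro v hv hne
    rw [hwz, Bf_add_right, hz v hv hne, Bf_smul_right, zero_add]

theorem amgm4 (a b c d : ℤ) (ha : 0 < a) (hb : 0 < b) (hc : 0 < c) (hd : 0 < d) :
    256 * (a * b * c * d) ≤ (a + b + c + d) ^ 4 := by
  have h1 : 4 * (a * b) ≤ (a + b) ^ 2 := by nlinarith [sq_nonneg (a - b)]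
  have h2 : 4 * (c * d) ≤ (c + d) ^ 2 := by nlinarith [sq_nonneg (c - d)]
  have h3 : 4 * ((a + b) * (c + d)) ≤ (a + b + (c + d)) ^ 2 := by
    nlinarith [sq_nonneg (a + b - (c + d))]
  have h4 : 16 * (a * b * c * d) ≤ ((a + b) * (c + d)) ^ 2 := by
    have := mul_le_mul h1 h2 (by positivity) (by positivity)
    calc _ = 4 * (a * b) * (4 * (c * d)) := by ring
      _ ≤ _ := this
      _ = _ := by ring
  have h5 : (4 * ((a + b) * (c + d))) ^ 2 ≤ ((a + b + (c + d)) ^ 2) ^ 2 :=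
    pow_le_pow_left₀ (by positivity) h3 2
  calc 256 * (a * b * c * d) = 16 * (16 * (a * b * c * d)) := by ring
    _ ≤ 16 * ((a + b) * (c + d)) ^ 2 := by linarith
    _ = (4 * ((a + b) * (c + d))) ^ 2 := by ring
    _ ≤ _ := h5
    _ = _ := by ring

theorem prod_dvd_aux (Pp Pq : Finset ℕ) (hP : ∀ p ∈ Pp ∪ Pq, p.Prime) (hdis : Disjoint Pp Pq)
    (X : ℤ) (hX : 0 < X) (h2 : ∀ p ∈ Pp, (p : ℤ) ^ 2 ∣ X) (h1 : ∀ p ∈ Pq, (p : ℤ) ∣ X) :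
    (((∏ p ∈ Pp, p ^ 2) * ∏ p ∈ Pq, p : ℕ) : ℤ) ≤ X := by
  have hcast : (((∏ p ∈ Pp, p ^ 2) * ∏ p ∈ Pq, p : ℕ) : ℤ) ∣ X := by
    rw [Int.natCast_dvd]
    apply Nat.Coprime.mul_dvd_of_dvd_of_dvd
    · apply Nat.Coprime.prod_left
      intro p hp
      apply Nat.Coprime.prod_right
      intro q hq
      apply Nat.Coprime.pow_left
      apply (Nat.coprime_primes (hP p (Finset.mem_union_left _ hp))
        (hP q (Finset.mem_union_right _ hq))).2
      rintro rfl
      exact Finset.disjoint_left.1 hdis hp hq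
    · apply Finset.prod_dvd_of_isRelPrime
      · intro p hp q hq hpq
        apply Nat.coprime_iff_isRelPrime.1
        apply Nat.Coprime.pow
        exact (Nat.coprime_primes (hP p (Finset.mem_union_left _ hp))
          (hP q (Finset.mem_union_left _ hq))).2 hpq
      · intro p hp
        have := h2 p hp
        rw [← Int.natCast_dvd]; exact_mod_cast this
    · apply Finset.prod_primes_dvd
      · intro p hp; exact (hP p (Finset.mem_union_right _ hp)).prime
      · intro p hp; exact Int.natCast_dvd.1 (h1 p hp)
  exact Int.le_of_dvd hX hcast

end Size

/-! ### Part 6: choosing the neighbour vector -/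

section Choice

variable {G : Matrix (Fin 4) (Fin 4) ℤ}

theorem ndvd_small {l : ℕ} {k : ℤ} (h1 : 0 < k) (h2 : k < l) : ¬ (l : ℤ) ∣ k := by
  intro h; have := Int.le_of_dvd h1 h; omega

theorem adjust {l : ℕ} (hl : l.Prime) (h5 : 5 ≤ l) (X N c : ℤ) (hN : ¬ (l : ℤ) ∣ N)
    (hc : ¬ (l : ℤ) ∣ c) (h : (l : ℤ) ∣ X + N * c ^ 2) :
    ∃ t : ℤ, (l : ℤ) ^ 2 ∣ X + N * (c + l * t) ^ 2 := by
  have hprime := Nat.prime_iff_prime_int.mp hl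
  have h2 : ¬ (l : ℤ) ∣ 2 := ndvd_small (by norm_num) (by omega)
  have hco : IsCoprime (l : ℤ) (2 * N * c) := by
    rw [hprime.coprime_iff_not_dvd]
    intro h0
    rcases hprime.dvd_or_dvd h0 with h0 | h0
    · exact (hprime.dvd_or_dvd h0).elim h2 hN
    · exact hc h0
  obtain ⟨a, b, hab⟩ := hco
  obtain ⟨k, hk⟩ := h
  refine ⟨-k * b, k * a + N * (k * b) ^ 2, ?_⟩
  have : X = l * k - N * c ^ 2 := by linarith
  rw [this]
  linear_combination -(l : ℤ) * k * hab

theorem c4_choice {l : ℕ} (hl : l.Prime) (h5 : 5 ≤ l) (n3 n4 : ℤ) (h3 : ¬ (l : ℤ) ∣ n3) :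
    ∃ c : ℤ, ¬ (l : ℤ) ∣ c ∧ ¬ (l : ℤ) ∣ n3 + n4 * c ^ 2 := by
  have hprime := Nat.prime_iff_prime_int.mp hl
  by_cases h : (l : ℤ) ∣ n3 + n4 * 1 ^ 2
  · refine ⟨2, ndvd_small (by norm_num) (by omega), fun h' => h3 ?_⟩
    have h4 : (l : ℤ) ∣ 3 * n4 := by
      have := dvd_sub h' h
      have e : n3 + n4 * 2 ^ 2 - (n3 + n4 * 1 ^ 2) = 3 * n4 := by ring
      rwa [e] at this
    rcases hprime.dvd_or_dvd h4 with h4 | h4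
    · exact absurd h4 (ndvd_small (by norm_num) (by omega))
    · have := dvd_sub h (h4.mul_right (1 ^ 2)); simpa using this
  · exact ⟨1, ndvd_small (by norm_num) (by omega), h⟩

theorem bin_solve {l : ℕ} (hl : l.Prime) (h5 : 5 ≤ l) (a b m : ℤ) (ha : ¬ (l : ℤ) ∣ a)
    (hb : ¬ (l : ℤ) ∣ b) : ∃ x y : ℤ, (l : ℤ) ∣ a * x ^ 2 + b * y ^ 2 - m := by
  have := Fact.mk hl
  have ha' : (a : ZMod l) ≠ 0 := by rwa [Ne, ZMod.intCast_zmod_eq_zero_iff_dvd]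
  have hb' : (b : ZMod l) ≠ 0 := by rwa [Ne, ZMod.intCast_zmod_eq_zero_iff_dvd]
  have hodd : Fintype.card (ZMod l) % 2 = 1 := by
    rw [ZMod.card]
    rcases hl.eq_two_or_odd with h | h <;> omega
  obtain ⟨x, y, hxy⟩ := FiniteField.exists_root_sum_quadratic
    (f := Polynomial.C (a : ZMod l) * Polynomial.X ^ 2)
    (g := Polynomial.C (b : ZMod l) * Polynomial.X ^ 2 + Polynomial.C 0 * Polynomial.X
      + Polynomial.C (-(m : ZMod l)))
    (Polynomial.degree_C_mul_X_pow 2 ha') (Polynomial.degree_quadratic hb') hodd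
  obtain ⟨x', hx'⟩ := ZMod.intCast_surjective x
  obtain ⟨y', hy'⟩ := ZMod.intCast_surjective y
  refine ⟨x', y', ?_⟩
  rw [← ZMod.intCast_zmod_eq_zero_iff_dvd]
  push_cast
  rw [hx', hy', ← hxy]
  simp
  ring

theorem tern_aux {F : Type*} [Field F] [Fintype F] (h2 : (2 : F) ≠ 0)
    (hF : 7 ≤ Fintype.card F) (a b c t : F) (ha : a ≠ 0) (hb : b ≠ 0) (ht : t ≠ 0)
    (h : a * t ^ 2 + c = 0) :
    ∃ x y z : F, x ≠ 0 ∧ y ≠ 0 ∧ z ≠ 0 ∧ a * x ^ 2 + b * y ^ 2 + c * z ^ 2 = 0 := by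
  obtain ⟨s, hs⟩ : ∃ s : F, s * (s ^ 4 - (b / a) ^ 2) ≠ 0 := by
    by_contra! hcon
    obtain ⟨f, hf⟩ : ∃ f : Polynomial F,
      f = Polynomial.X * (Polynomial.X ^ 4 - Polynomial.C ((b / a) ^ 2)) := ⟨_, rfl⟩
    have hdeg : f.natDegree = 5 := by
      rw [hf]; compute_degree!
    have hf0 : f ≠ 0 := by rintro rfl; simp at hdeg
    have hroots : (Finset.univ : Finset F).val ≤ f.roots := by
      rw [Multiset.le_iff_subset Finset.univ.nodup]
      intro s _
      rw [Polynomial.mem_roots hf0, Polynomial.IsRoot, hf]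
      simpa using hcon s
    have := Multiset.card_le_card hroots
    have h3 := Polynomial.card_roots' f
    simp only [Finset.card_val, Finset.card_univ] at this
    omega
  have hs0 : s ≠ 0 := left_ne_zero_of_mul hs
  have hs4 : s ^ 4 - (b / a) ^ 2 ≠ 0 := right_ne_zero_of_mul hs
  refine ⟨(s - b / (a * s)) / 2, 1, (-(b / (a * s)) - s) / (2 * t), ?_, one_ne_zero, ?_, ?_⟩
  · intro h0
    apply hs4
    have : s - b / (a * s) = 0 := by
      rcases div_eq_zero_iff.1 h0 with h | h
      · exact h
      · exact absurd h h2
    field_simp at this ⊢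
    linear_combination (a * s ^ 2 + b) * this
  · intro h0
    apply hs4
    have : -(b / (a * s)) - s = 0 := by
      rcases div_eq_zero_iff.1 h0 with h | h
      · exact h
      · exact absurd h (mul_ne_zero h2 ht)
    field_simp at this ⊢
    linear_combination (b - a * s ^ 2) * this
  · have hc : c = - a * t ^ 2 := by linear_combination h
    rw [hc]
    field_simp
    ring

theorem tern_field {F : Type*} [Field F] [Fintype F] (h2 : (2 : F) ≠ 0)
    (hF : 7 ≤ Fintype.card F) (a b c x y : F) (ha : a ≠ 0) (hb : b ≠ 0) (hc : c ≠ 0)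
    (h : a * x ^ 2 + b * y ^ 2 + c = 0) :
    ∃ x y z : F, x ≠ 0 ∧ y ≠ 0 ∧ z ≠ 0 ∧ a * x ^ 2 + b * y ^ 2 + c * z ^ 2 = 0 := by
  by_cases hx : x = 0
  · have hy : y ≠ 0 := by rintro rfl; apply hc; simpa [hx] using h
    obtain ⟨u, v, w, hu, hv, hw, e⟩ := tern_aux h2 hF b a c y hb ha hy (by rw [← h, hx]; ring)
    exact ⟨v, u, w, hv, hu, hw, by rw [← e]; ring⟩
  · by_cases hy : y = 0
    · exact tern_aux h2 hF a b c x ha hb hx (by rw [← h, hy]; ring)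
    · exact ⟨x, y, 1, hx, hy, one_ne_zero, by rw [← h]; ring⟩

theorem tern_solve {l : ℕ} (hl : l.Prime) (h7 : 7 ≤ l) (a b c : ℤ) (ha : ¬ (l : ℤ) ∣ a)
    (hb : ¬ (l : ℤ) ∣ b) (hc : ¬ (l : ℤ) ∣ c) :
    ∃ x y z : ℤ, ¬ (l : ℤ) ∣ x ∧ ¬ (l : ℤ) ∣ y ∧ ¬ (l : ℤ) ∣ z ∧
      (l : ℤ) ∣ a * x ^ 2 + b * y ^ 2 + c * z ^ 2 := by
  have := Fact.mk hl
  obtain ⟨x, y, hxy⟩ := bin_solve hl (by omega) a b (-c) ha hb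
  simp only [← ZMod.intCast_zmod_eq_zero_iff_dvd] at *
  have h2 : (2 : ZMod l) ≠ 0 := by
    have : ¬ (l : ℤ) ∣ 2 := ndvd_small (by norm_num) (by omega)
    rw [← ZMod.intCast_zmod_eq_zero_iff_dvd] at this
    simpa using this
  obtain ⟨u, v, w, hu, hv, hw, e⟩ := tern_field (F := ZMod l) h2 (by rw [ZMod.card]; exact h7)
    a b c x y ha hb hc (by push_cast at hxy; rw [← hxy]; ring)
  obtain ⟨u, rfl⟩ := ZMod.intCast_surjective u
  obtain ⟨v, rfl⟩ := ZMod.intCast_surjective v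
  obtain ⟨w, rfl⟩ := ZMod.intCast_surjective w
  exact ⟨u, v, w, hu, hv, hw, by push_cast; exact e⟩

theorem plane_repr (hs : G.IsSymm) (hp : PosDefM G) {l : ℕ} (hl : l.Prime) (h5 : 5 ≤ l)
    (v1 v2 : Fin 4 → ℤ) (hv1 : RL G v1) (hv2 : RL G v2)
    (hli : ∀ a b : ℤ, a • v1 + b • v2 = 0 → a = 0)
    (h1 : ¬ (l : ℤ) ∣ Bf G v1 v1) (h2 : ¬ (l : ℤ) ∣ Bf G v2 v2) (m : ℤ) (hm : ¬ (l : ℤ) ∣ m) :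
    ∃ α β : ℤ, (l : ℤ) ∣ Bf G (α • v1 + β • v2) (α • v1 + β • v2) - m ∧
      (¬ (l : ℤ) ∣ Bf G v1 (α • v1 + β • v2) ∨ ¬ (l : ℤ) ∣ Bf G v2 (α • v1 + β • v2)) := by
  have hprime := Nat.prime_iff_prime_int.mp hl
  have hcs := Bf_cs_strict hs hp v1 v2 hv2.1 hli
  obtain ⟨a, ha⟩ := hv1.2 v2
  obtain ⟨a', ha'⟩ := hv2.2 v1
  have hba : Bf G v2 v1 = Bf G v1 v2 := Bf_comm hs _ _
  rw [hba] at ha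
  have hr := aa_range (a := a') (a' := a) hv1.1 hv2.1 (by linarith) (by linarith) hcs
  have hunit : ¬ (l : ℤ) ∣ Bf G v2 v2 * (4 - a * a') := by
    intro h
    rcases hprime.dvd_or_dvd h with h | h
    · exact h2 h
    · refine ndvd_small ?_ ?_ h
      · nlinarith [hr.2]
      · have : (5 : ℤ) ≤ l := by exact_mod_cast h5
        nlinarith [hr.1]
  obtain ⟨x, y, hxy⟩ := bin_solve hl h5 _ _ m h1 hunit
  have hQ : (l : ℤ) ∣ Bf G ((x - a * y) • v1 + (2 * y) • v2) ((x - a * y) • v1 + (2 * y) • v2)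
      - m := by
    convert hxy using 2
    simp only [Bf_add_left, Bf_add_right, Bf_smul_left, Bf_smul_right, hba]
    linear_combination (2 * x * y - a * y ^ 2) * ha - a * y ^ 2 * ha'
  refine ⟨_, _, hQ, ?_⟩
  by_contra! hcon
  apply hm
  generalize hα : x - a * y = α at *
  generalize hβ : 2 * y = β at *
  have e : Bf G (α • v1 + β • v2) (α • v1 + β • v2)
      = α * Bf G v1 (α • v1 + β • v2) + β * Bf G v2 (α • v1 + β • v2) := by
    rw [Bf_add_left, Bf_smul_left, Bf_smul_left]
  have h3 := dvd_add (hcon.1.mul_left α) (hcon.2.mul_left β)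
  rw [← e] at h3
  have := dvd_sub h3 hQ
  simpa using this

end Choice

/-! ### Part 7: the three root configurations -/

section Config

variable {G : Matrix (Fin 4) (Fin 4) ℤ}

/-- The data shared by all configurations. -/
structure Cfg (G : Matrix (Fin 4) (Fin 4) ℤ) (Pp Pq : Finset ℕ) (v : Fin 4 → Fin 4 → ℤ) :
    Prop where
  hs : G.IsSymm
  hp : PosDefM G
  hsf : SquareFreeM G
  htr : TotallyReflectiveM G
  hv : ∀ i, RL G (v i)
  hli : LinearIndependent ℤ v
  prime : ∀ p ∈ Pp ∪ Pq, p.Prime ∧ 5 ≤ p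
  dis : Disjoint Pp Pq
  two : ∀ p ∈ Pp, (Finset.univ.filter fun i => (p : ℤ) ∣ Bf G (v i) (v i)).card = 2
  one : ∀ p ∈ Pq, (Finset.univ.filter fun i => (p : ℤ) ∣ Bf G (v i) (v i)).card = 1

/-- Some prime of `P` divides exactly one of the two norms. -/
def SepL (G : Matrix (Fin 4) (Fin 4) ℤ) (P : Finset ℕ) (u v : Fin 4 → ℤ) : Prop :=
  ∃ p ∈ P, ¬ ((p : ℤ) ∣ Bf G u u ↔ (p : ℤ) ∣ Bf G v v)

theorem sep_trans (hs : G.IsSymm) (hp : PosDefM G) {P : Finset ℕ}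
    (hP : ∀ p ∈ P, p.Prime ∧ 5 ≤ p) {u v w : Fin 4 → ℤ} (hu : RL G u) (hv : RL G v)
    (hw : RL G w) (h : SepL G P u v) (hne : Bf G w v ≠ 0) : Bf G w u = 0 := by
  by_contra hwu
  obtain ⟨p, hpP, hnot⟩ := h
  obtain ⟨hpp, h5⟩ := hP p hpP
  have hne' : Bf G v w ≠ 0 := by rwa [Bf_comm hs]
  have hwu' : Bf G u w ≠ 0 := by rwa [Bf_comm hs]
  apply hnot
  constructor
  · intro h
    exact label_dvd hs hp hw hv hne hpp h5 (label_dvd hs hp hu hw hwu' hpp h5 h)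
  · intro h
    exact label_dvd hs hp hw hu hwu hpp h5 (label_dvd hs hp hv hw hne' hpp h5 h)

theorem sep_orth (hs : G.IsSymm) (hp : PosDefM G) {P : Finset ℕ}
    (hP : ∀ p ∈ P, p.Prime ∧ 5 ≤ p) {u v : Fin 4 → ℤ} (hu : RL G u) (hv : RL G v)
    (h : SepL G P u v) : Bf G u v = 0 := by
  rw [Bf_comm hs]
  exact sep_trans hs hp hP hu hv hv h hv.1.ne'

theorem sq_dvd_of {p a b : ℤ} (ha : p ∣ a) (hb : p ∣ b) : p ^ 2 ∣ a * b := by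
  rw [pow_two]; exact mul_dvd_mul ha hb

theorem li_pair {v : Fin 4 → Fin 4 → ℤ} (h : LinearIndependent ℤ v) :
    ∀ a b : ℤ, a • v 0 + b • v 1 = 0 → a = 0 := by
  intro a b hab
  have := Fintype.linearIndependent_iff.1 h ![a, b, 0, 0] (by
    rw [Fin.sum_univ_four]; simpa using hab) 0
  simpa using this

theorem cfgFour {Pp Pq : Finset ℕ} {v : Fin 4 → Fin 4 → ℤ} (c : Cfg G Pp Pq v)
    (sep : ∀ i j, i ≠ j → SepL G (Pp ∪ Pq) (v i) (v j)) {l : ℕ} (hl : l.Prime) (h7 : 7 ≤ l)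
    (h0 : ¬ (l : ℤ) ∣ Bf G (v 0) (v 0)) (h1 : ¬ (l : ℤ) ∣ Bf G (v 1) (v 1))
    (h2 : ¬ (l : ℤ) ∣ Bf G (v 2) (v 2))
    (hbig : l ^ 8 < (∏ p ∈ Pp, p ^ 2) * ∏ p ∈ Pq, p) : False := by
  have hprime := Nat.prime_iff_prime_int.mp hl
  have orth : ∀ i j, i ≠ j → Bf G (v i) (v j) = 0 := fun i j hij =>
    sep_orth c.hs c.hp c.prime (c.hv i) (c.hv j) (sep i j hij)
  obtain ⟨c4, hc4, he⟩ := c4_choice hl (by omega) _ (Bf G (v 3) (v 3)) h2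
  obtain ⟨x, y, z, hx, hy, hz, hxyz⟩ := tern_solve hl h7 _ _ _ h0 h1 he
  obtain ⟨t, ht⟩ := adjust hl (by omega) (Bf G (v 0) (v 0) * x ^ 2 + Bf G (v 1) (v 1) * y ^ 2
    + Bf G (v 3) (v 3) * (z * c4) ^ 2) (Bf G (v 2) (v 2)) z h2 hz
    (by convert hxyz using 1; ring)
  obtain ⟨z', hz'⟩ : ∃ z', z' = z + l * t := ⟨_, rfl⟩
  rw [← hz'] at ht
  have hzl : ¬ (l : ℤ) ∣ z' := by
    rw [hz']; intro h; exact hz ((dvd_add_left (dvd_mul_right _ _)).1 h)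
  have e : ∀ i, Bf G (v i) (x • v 0 + y • v 1 + z' • v 2 + (z * c4) • v 3)
      = ![x, y, z', z * c4] i * Bf G (v i) (v i) := by
    intro i
    simp only [Bf_add_right, Bf_smul_right]
    fin_cases i <;> simp [orth]
  refine core c.hs c.hp c.hsf c.htr hl (by omega) v c.hv orth 3 0 (by decide)
    (x • v 0 + y • v 1 + z' • v 2 + (z * c4) • v 3) (x • v 0 + y • v 1 + z' • v 2) (z * c4)
    ?_ rfl ?_ ?_ ?_ ?_
  · intro h; exact (hprime.dvd_or_dvd h).elim hz hc4
  · convert ht using 1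
    conv_lhs => rw [Bf_add_left, Bf_add_left, Bf_add_left, Bf_smul_left, Bf_smul_left,
      Bf_smul_left, Bf_smul_left, e, e, e, e]
    simp
    ring
  · intro u hu hne
    have := fun j hj => sep_trans c.hs c.hp c.prime (c.hv j) (c.hv 3) hu (sep j 3 hj) hne
    simp only [Bf_add_right, Bf_smul_right, this 0 (by decide), this 1 (by decide),
      this 2 (by decide), mul_zero, add_zero]
  · intro i hi
    rw [e]
    intro h
    fin_cases i
    · exact (hprime.dvd_or_dvd h).elim hx h0
    · exact (hprime.dvd_or_dvd h).elim hy h1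
    · exact (hprime.dvd_or_dvd h).elim hzl h2
    · exact hi rfl
  · intro n δ hδ hsum hdiv
    rw [Fin.sum_univ_four] at hsum
    have ham := amgm4 (δ 0) (δ 1) (δ 2) (δ 3) (hδ 0) (hδ 1) (hδ 2) (hδ 3)
    have hpos : 0 < δ 0 * δ 1 * δ 2 * δ 3 := by
      have := hδ 0; have := hδ 1; have := hδ 2; have := hδ 3; positivity
    have hle : (δ 0 + δ 1 + δ 2 + δ 3) ^ 4 ≤ (4 * (l : ℤ) ^ 2) ^ 4 :=
      pow_le_pow_left₀ (by have := hδ 0; have := hδ 1; have := hδ 2; have := hδ 3; positivity)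
        hsum 4
    have hprod : δ 0 * δ 1 * δ 2 * δ 3 = ∏ i, δ i := by rw [Fin.prod_univ_four]
    have hD := prod_dvd_aux Pp Pq (fun p hp => (c.prime p hp).1) c.dis
      (δ 0 * δ 1 * δ 2 * δ 3) hpos ?_ ?_
    · have : ((l ^ 8 : ℕ) : ℤ) < (((∏ p ∈ Pp, p ^ 2) * ∏ p ∈ Pq, p : ℕ) : ℤ) := by
        exact_mod_cast hbig
      have e8 : (4 * (l : ℤ) ^ 2) ^ 4 = 256 * ((l ^ 8 : ℕ) : ℤ) := by push_cast; ring
      rw [e8] at hle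
      linarith
    · intro p hp
      have hpr := (c.prime p (Finset.mem_union_left _ hp)).1
      have key : ∃ s : Finset (Fin 4), s.card = 2 ∧ ∀ i ∈ s, (p : ℤ) ∣ δ i := by
        by_cases hn : (p : ℤ) ∣ n
        · refine ⟨Finset.univ.filter fun i => ¬ (p : ℤ) ∣ Bf G (v i) (v i), ?_, ?_⟩
          · have h1 := c.two p hp
            have h2 := Finset.card_filter_add_card_filter_not (s := (Finset.univ : Finset (Fin 4)))
              (fun i => (p : ℤ) ∣ Bf G (v i) (v i))
            simp only [Finset.card_univ, Fintype.card_fin] at h2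
            omega
          · intro i hi
            rw [Finset.mem_filter] at hi
            exact hdiv p i hpr fun h => hi.2 (h.1 hn)
        · refine ⟨_, c.two p hp, ?_⟩
          intro i hi
          rw [Finset.mem_filter] at hi
          exact hdiv p i hpr fun h => hn (h.2 hi.2)
      obtain ⟨s, hs2, hs⟩ := key
      obtain ⟨i, j, hij, rfl⟩ := Finset.card_eq_two.1 hs2
      refine (sq_dvd_of (hs i (by simp)) (hs j (by simp))).trans ?_
      rw [hprod, ← Finset.prod_pair hij]
      exact Finset.prod_dvd_prod_of_subset _ _ _ (Finset.subset_univ _)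
    · intro p hp
      have hpr := (c.prime p (Finset.mem_union_right _ hp)).1
      have key : ∃ i, (p : ℤ) ∣ δ i := by
        have h1 := c.one p hp
        by_cases hn : (p : ℤ) ∣ n
        · by_contra! hcon
          have : (Finset.univ.filter fun i => (p : ℤ) ∣ Bf G (v i) (v i)) = Finset.univ := by
            rw [Finset.filter_eq_self]
            intro i _
            by_contra hh
            exact hcon i (hdiv p i hpr fun h => hh (h.1 hn))
          rw [this] at h1
          simp at h1
        · obtain ⟨i, hi⟩ := Finset.card_eq_one.1 h1
          have : i ∈ (Finset.univ.filter fun i => (p : ℤ) ∣ Bf G (v i) (v i)) := by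
            rw [hi]; simp
          rw [Finset.mem_filter] at this
          exact ⟨i, hdiv p i hpr fun h => hn (h.2 this.2)⟩
      obtain ⟨i, hi⟩ := key
      rw [hprod]
      exact hi.trans (Finset.dvd_prod_of_mem _ (Finset.mem_univ i))

theorem key_two {A0 A1 A2 A3 N da db dd : Prop} [Decidable A0] [Decidable A1] [Decidable A2]
    [Decidable A3] (hs : A0 ↔ A1) (h : (if A0 then 1 else 0) + (if A1 then 1 else 0)
      + (if A2 then 1 else 0) + (if A3 then 1 else 0) = 2)
    (k0 : ¬ (N ↔ A0) → da) (k1 : ¬ (N ↔ A2) → db) (k2 : ¬ (N ↔ A3) → dd) : da ∨ (db ∧ dd) := by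
  by_cases hN : N <;> by_cases a0 : A0 <;> by_cases a2 : A2 <;> by_cases a3 : A3 <;> simp_all

theorem key_one {A0 A1 A2 A3 N da db dd : Prop} [Decidable A0] [Decidable A1] [Decidable A2]
    [Decidable A3] (hs : A0 ↔ A1) (h : (if A0 then 1 else 0) + (if A1 then 1 else 0)
      + (if A2 then 1 else 0) + (if A3 then 1 else 0) = 1)
    (k0 : ¬ (N ↔ A0) → da) (k1 : ¬ (N ↔ A2) → db) (k2 : ¬ (N ↔ A3) → dd) : da ∨ db ∨ dd := by
  by_cases hN : N <;> by_cases a0 : A0 <;> by_cases a2 : A2 <;> by_cases a3 : A3 <;> simp_all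

theorem cfgThree {Pp Pq : Finset ℕ} {v : Fin 4 → Fin 4 → ℤ} (c : Cfg G Pp Pq v)
    (same : ∀ p ∈ Pp ∪ Pq, ((p : ℤ) ∣ Bf G (v 0) (v 0) ↔ (p : ℤ) ∣ Bf G (v 1) (v 1)))
    (s02 : SepL G (Pp ∪ Pq) (v 0) (v 2)) (s03 : SepL G (Pp ∪ Pq) (v 0) (v 3))
    (s12 : SepL G (Pp ∪ Pq) (v 1) (v 2)) (s13 : SepL G (Pp ∪ Pq) (v 1) (v 3))
    (s23 : SepL G (Pp ∪ Pq) (v 2) (v 3)) {l : ℕ} (hl : l.Prime) (h5 : 5 ≤ l)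
    (h0 : ¬ (l : ℤ) ∣ Bf G (v 0) (v 0)) (h1 : ¬ (l : ℤ) ∣ Bf G (v 1) (v 1))
    (h2 : ¬ (l : ℤ) ∣ Bf G (v 2) (v 2))
    (hbig : 4 * l ^ 8 < (∏ p ∈ Pp, p ^ 2) * ∏ p ∈ Pq, p) : False := by
  have o02 := sep_orth c.hs c.hp c.prime (c.hv 0) (c.hv 2) s02
  have o03 := sep_orth c.hs c.hp c.prime (c.hv 0) (c.hv 3) s03
  have o12 := sep_orth c.hs c.hp c.prime (c.hv 1) (c.hv 2) s12
  have o13 := sep_orth c.hs c.hp c.prime (c.hv 1) (c.hv 3) s13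
  have o23 := sep_orth c.hs c.hp c.prime (c.hv 2) (c.hv 3) s23
  have hprime := Nat.prime_iff_prime_int.mp hl
  obtain ⟨c4, hc4, he⟩ := c4_choice hl h5 _ (Bf G (v 3) (v 3)) h2
  obtain ⟨α, β, hQ, hor⟩ := plane_repr c.hs c.hp hl h5 (v 0) (v 1) (c.hv 0) (c.hv 1)
    (li_pair c.hli) h0 h1 (-(Bf G (v 2) (v 2) + Bf G (v 3) (v 3) * c4 ^ 2))
    (by rwa [dvd_neg])
  have oz2 : Bf G (α • v 0 + β • v 1) (v 2) = 0 := by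
    simp only [mul_zero, add_zero, Bf_add_left, Bf_smul_left, o02, o12]
  have oz3 : Bf G (α • v 0 + β • v 1) (v 3) = 0 := by
    simp only [mul_zero, add_zero, Bf_add_left, Bf_smul_left, o03, o13]
  have hzz : ∀ u, RL G u → Bf G u (v 3) ≠ 0 → Bf G u (α • v 0 + β • v 1) = 0 := by
    intro u hu hne
    simp only [mul_zero, add_zero, Bf_add_right, Bf_smul_right,
      sep_trans c.hs c.hp c.prime (c.hv 0) (c.hv 3) hu s03 hne,
      sep_trans c.hs c.hp c.prime (c.hv 1) (c.hv 3) hu s13 hne]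
  obtain ⟨r1, hr1, o12', o13', hlab, hnd⟩ : ∃ r1, RL G r1 ∧ Bf G r1 (v 2) = 0 ∧
      Bf G r1 (v 3) = 0 ∧
      (∀ p ∈ Pp ∪ Pq, ((p : ℤ) ∣ Bf G r1 r1 ↔ (p : ℤ) ∣ Bf G (v 0) (v 0))) ∧
      ¬ (l : ℤ) ∣ Bf G r1 (α • v 0 + β • v 1) := by
    rcases hor with h | h
    · exact ⟨v 0, c.hv 0, o02, o03, fun _ _ => Iff.rfl, h⟩
    · exact ⟨v 1, c.hv 1, o12, o13, fun p hp => (same p hp).symm, h⟩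
  generalize α • v 0 + β • v 1 = z at *
  obtain ⟨t, ht⟩ := adjust hl h5 (Bf G z z + Bf G (v 3) (v 3) * c4 ^ 2) (Bf G (v 2) (v 2)) 1 h2
    (ndvd_small (by norm_num) (by omega)) (by convert hQ using 1; ring)
  obtain ⟨c3, hc3⟩ : ∃ c3, c3 = 1 + l * t := ⟨_, rfl⟩
  rw [← hc3] at ht
  have hcl : ¬ (l : ℤ) ∣ c3 := by
    rw [hc3]; intro h
    exact ndvd_small (by norm_num) (by omega) ((dvd_add_left (dvd_mul_right _ _)).1 h)
  have orth : ∀ i j : Fin 3, i ≠ j → Bf G (![r1, v 2, v 3] i) (![r1, v 2, v 3] j) = 0 := by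
    intro i j hij
    have o21 := o12'; have o31 := o13'; have o32 := o23
    rw [Bf_comm c.hs] at o21 o31 o32
    fin_cases i <;> fin_cases j <;> simp_all
  refine core c.hs c.hp c.hsf c.htr hl h5 ![r1, v 2, v 3] ?_ orth 2 0 (by decide)
    (z + c3 • v 2 + c4 • v 3) (z + c3 • v 2) c4 hc4 rfl ?_ ?_ ?_ ?_
  · intro i
    fin_cases i
    · exact hr1
    · exact c.hv 2
    · exact c.hv 3
  · convert ht using 1
    simp only [Bf_add_left, Bf_add_right, Bf_smul_left, Bf_smul_right, oz2, oz3, o23,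
      Bf_comm c.hs (v 2) z, Bf_comm c.hs (v 3) z, Bf_comm c.hs (v 3) (v 2)]
    ring
  · intro u hu hne
    have hne' : Bf G u (v 3) ≠ 0 := hne
    rw [Bf_add_right, Bf_smul_right, hzz u hu hne',
      sep_trans c.hs c.hp c.prime (c.hv 2) (c.hv 3) hu s23 hne', mul_zero, add_zero]
  · intro i hi
    fin_cases i
    · show ¬ (l : ℤ) ∣ Bf G r1 _
      simpa only [mul_zero, add_zero, Bf_add_right, Bf_smul_right, o12', o13'] using hnd
    · show ¬ (l : ℤ) ∣ Bf G (v 2) _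
      simp only [Bf_add_right, Bf_smul_right, Bf_comm c.hs (v 2) z, oz2, o23, mul_zero, add_zero,
        zero_add]
      intro h
      exact (hprime.dvd_or_dvd h).elim hcl h2
    · exact absurd rfl hi
  · intro n δ hδ hsum hdiv
    rw [Fin.sum_univ_three] at hsum
    have p0 := hδ 0
    have p1 := hδ 1
    have p2 := hδ 2
    have d0 := fun p hp => hdiv p 0 hp
    have d1 := fun p hp => hdiv p 1 hp
    have d2 := fun p hp => hdiv p 2 hp
    simp only [Matrix.cons_val_zero, Matrix.cons_val_one, Matrix.cons_val_two, Matrix.head_cons,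
      Matrix.tail_cons] at d0 d1 d2
    generalize δ 0 = a at *
    generalize δ 1 = b at *
    generalize δ 2 = d at *
    have ham := amgm4 a a (2 * b) (2 * d) p0 p0 (by positivity) (by positivity)
    have hpos : 0 < a ^ 2 * (b * d) := by positivity
    have hle : (a + a + 2 * b + 2 * d) ^ 4 ≤ (8 * (l : ℤ) ^ 2) ^ 4 :=
      pow_le_pow_left₀ (by positivity) (by linarith) 4
    have hD := prod_dvd_aux Pp Pq (fun p hp => (c.prime p hp).1) c.dis
      (a ^ 2 * (b * d)) hpos ?_ ?_
    · have : ((4 * l ^ 8 : ℕ) : ℤ) < (((∏ p ∈ Pp, p ^ 2) * ∏ p ∈ Pq, p : ℕ) : ℤ) := by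
        exact_mod_cast hbig
      have e8 : (8 * (l : ℤ) ^ 2) ^ 4 = 1024 * ((4 * l ^ 8 : ℕ) : ℤ) := by push_cast; ring
      rw [e8] at hle
      have e9 : 256 * (a * a * (2 * b) * (2 * d)) = 1024 * (a ^ 2 * (b * d)) := by ring
      linarith
    · intro p hp
      have hmem := Finset.mem_union_left Pq hp
      have hpr := (c.prime p hmem).1
      have hcard := c.two p hp
      rw [Finset.card_filter, Fin.sum_univ_four] at hcard
      have hsame := same p hmem
      have hl1 := hlab p hmem
      have k0 := d0 p hpr
      have k1 := d1 p hpr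
      have k2 := d2 p hpr
      rw [hl1] at k0
      have key : (p : ℤ) ∣ a ∨ ((p : ℤ) ∣ b ∧ (p : ℤ) ∣ d) := by
        exact key_two hsame hcard k0 k1 k2
      rcases key with h | h
      · exact (pow_dvd_pow_of_dvd h 2).mul_right _
      · exact (sq_dvd_of h.1 h.2).mul_left _
    · intro p hp
      have hmem := Finset.mem_union_right Pp hp
      have hpr := (c.prime p hmem).1
      have hcard := c.one p hp
      rw [Finset.card_filter, Fin.sum_univ_four] at hcard
      have hsame := same p hmem
      have hl1 := hlab p hmem
      have k0 := d0 p hpr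
      have k1 := d1 p hpr
      have k2 := d2 p hpr
      rw [hl1] at k0
      have key : (p : ℤ) ∣ a ∨ (p : ℤ) ∣ b ∨ (p : ℤ) ∣ d := by
        exact key_one hsame hcard k0 k1 k2
      rcases key with h | h | h
      · exact (h.pow two_ne_zero).mul_right _
      · exact (h.mul_right _).mul_left _
      · exact (h.mul_left _).mul_left _

theorem cfgTwo {Pp Pq : Finset ℕ} {v : Fin 4 → Fin 4 → ℤ} (c : Cfg G Pp Pq v)
    (same : ∀ p ∈ Pp ∪ Pq, ((p : ℤ) ∣ Bf G (v 0) (v 0) ↔ (p : ℤ) ∣ Bf G (v 1) (v 1)))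
    (diff : ∀ p ∈ Pp ∪ Pq, ¬ ((p : ℤ) ∣ Bf G (v 0) (v 0) ↔ (p : ℤ) ∣ Bf G (v 3) (v 3)))
    {l : ℕ} (hl : l.Prime) (h5 : 5 ≤ l)
    (h0 : ¬ (l : ℤ) ∣ Bf G (v 0) (v 0)) (h1 : ¬ (l : ℤ) ∣ Bf G (v 1) (v 1))
    (h3 : ¬ (l : ℤ) ∣ Bf G (v 3) (v 3))
    (hbig : 4 * l ^ 4 < ∏ p ∈ Pp ∪ Pq, p) : False := by
  obtain ⟨p0, hp0⟩ : (Pp ∪ Pq).Nonempty := by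
    rw [Finset.nonempty_iff_ne_empty]
    intro h
    rw [h, Finset.prod_empty] at hbig
    have : 0 < l ^ 4 := by positivity
    omega
  have s03 : SepL G (Pp ∪ Pq) (v 0) (v 3) := ⟨p0, hp0, diff p0 hp0⟩
  have s13 : SepL G (Pp ∪ Pq) (v 1) (v 3) := ⟨p0, hp0, by rw [← same p0 hp0]; exact diff p0 hp0⟩
  have o03 := sep_orth c.hs c.hp c.prime (c.hv 0) (c.hv 3) s03
  have o13 := sep_orth c.hs c.hp c.prime (c.hv 1) (c.hv 3) s13
  have hprime := Nat.prime_iff_prime_int.mp hl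
  obtain ⟨α, β, hQ, hor⟩ := plane_repr c.hs c.hp hl h5 (v 0) (v 1) (c.hv 0) (c.hv 1)
    (li_pair c.hli) h0 h1 (-(Bf G (v 3) (v 3))) (by rwa [dvd_neg])
  have oz3 : Bf G (α • v 0 + β • v 1) (v 3) = 0 := by
    simp only [mul_zero, add_zero, Bf_add_left, Bf_smul_left, o03, o13]
  have hzz : ∀ u, RL G u → Bf G u (v 3) ≠ 0 → Bf G u (α • v 0 + β • v 1) = 0 := by
    intro u hu hne
    simp only [mul_zero, add_zero, Bf_add_right, Bf_smul_right,
      sep_trans c.hs c.hp c.prime (c.hv 0) (c.hv 3) hu s03 hne,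
      sep_trans c.hs c.hp c.prime (c.hv 1) (c.hv 3) hu s13 hne]
  obtain ⟨r1, hr1, o13', hlab, hnd⟩ : ∃ r1, RL G r1 ∧ Bf G r1 (v 3) = 0 ∧
      (∀ p ∈ Pp ∪ Pq, ((p : ℤ) ∣ Bf G r1 r1 ↔ (p : ℤ) ∣ Bf G (v 0) (v 0))) ∧
      ¬ (l : ℤ) ∣ Bf G r1 (α • v 0 + β • v 1) := by
    rcases hor with h | h
    · exact ⟨v 0, c.hv 0, o03, fun _ _ => Iff.rfl, h⟩
    · exact ⟨v 1, c.hv 1, o13, fun p hp => (same p hp).symm, h⟩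
  generalize α • v 0 + β • v 1 = z at *
  obtain ⟨t, ht⟩ := adjust hl h5 (Bf G z z) (Bf G (v 3) (v 3)) 1 h3
    (ndvd_small (by norm_num) (by omega)) (by convert hQ using 1; ring)
  obtain ⟨c3, hc3⟩ : ∃ c3, c3 = 1 + l * t := ⟨_, rfl⟩
  rw [← hc3] at ht
  have hcl : ¬ (l : ℤ) ∣ c3 := by
    rw [hc3]; intro h
    exact ndvd_small (by norm_num) (by omega) ((dvd_add_left (dvd_mul_right _ _)).1 h)
  have orth : ∀ i j : Fin 2, i ≠ j → Bf G (![r1, v 3] i) (![r1, v 3] j) = 0 := by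
    intro i j hij
    have o31 := o13'
    rw [Bf_comm c.hs] at o31
    fin_cases i <;> fin_cases j <;> simp_all
  refine core c.hs c.hp c.hsf c.htr hl h5 ![r1, v 3] ?_ orth 1 0 (by decide)
    (z + c3 • v 3) z c3 hcl rfl ?_ hzz ?_ ?_
  · intro i
    fin_cases i
    · exact hr1
    · exact c.hv 3
  · convert ht using 1
    simp only [Bf_add_left, Bf_add_right, Bf_smul_left, Bf_smul_right, oz3,
      Bf_comm c.hs (v 3) z]
    ring
  · intro i hi
    fin_cases i
    · show ¬ (l : ℤ) ∣ Bf G r1 _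
      simpa only [mul_zero, add_zero, Bf_add_right, Bf_smul_right, o13'] using hnd
    · exact absurd rfl hi
  · intro n δ hδ hsum hdiv
    rw [Fin.sum_univ_two] at hsum
    have p0 := hδ 0
    have p1 := hδ 1
    have d0 := fun p hp => hdiv p 0 hp
    have d1 := fun p hp => hdiv p 1 hp
    simp only [Matrix.cons_val_zero, Matrix.cons_val_one] at d0 d1
    generalize δ 0 = a at *
    generalize δ 1 = b at *
    have hpos : 0 < a * b := by positivity
    have hle : 4 * (a * b) ≤ (4 * (l : ℤ) ^ 2) ^ 2 := by
      have : (a + b) ^ 2 ≤ (4 * (l : ℤ) ^ 2) ^ 2 := pow_le_pow_left₀ (by positivity) hsum 2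
      nlinarith [sq_nonneg (a - b)]
    have hD := prod_dvd_aux ∅ (Pp ∪ Pq) (fun p hp => (c.prime p (by simpa using hp)).1)
      (Finset.disjoint_empty_left _) (a * b) hpos (by simp) ?_
    · have : ((4 * l ^ 4 : ℕ) : ℤ) < ((∏ p ∈ Pp ∪ Pq, p : ℕ) : ℤ) := by
        exact_mod_cast hbig
      have e8 : (4 * (l : ℤ) ^ 2) ^ 2 = 4 * ((4 * l ^ 4 : ℕ) : ℤ) := by push_cast; ring
      rw [e8] at hle
      rw [Finset.prod_empty, one_mul] at hD
      linarith
    · intro p hmem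
      have hpr := (c.prime p hmem).1
      have hd := diff p hmem
      have hl1 := hlab p hmem
      have k0 := d0 p hpr
      have k1 := d1 p hpr
      rw [hl1] at k0
      have key : (p : ℤ) ∣ a ∨ (p : ℤ) ∣ b := by tauto
      rcases key with h | h
      · exact h.mul_right _
      · exact h.mul_left _

end Config

/-! ### Part 8: estimates for products of primes -/

section Numerics

/-- The product of the primes in `[b, n)`. -/
def pprod (b n : ℕ) : ℕ := ∏ p ∈ (Finset.range n).filter (fun p => p.Prime ∧ b ≤ p), p

theorem pprod_ge {b n : ℕ} (S : Finset ℕ) (hS : ∀ p ∈ S, p.Prime ∧ b ≤ p ∧ p < n) :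
    ∏ p ∈ S, p ≤ pprod b n := by
  apply Finset.prod_le_prod_of_subset_of_one_le'
  · intro p hp
    obtain ⟨h1, h2, h3⟩ := hS p hp
    simp [h1, h2, h3]
  · intro p hp _
    rw [Finset.mem_filter] at hp
    exact hp.2.1.one_lt.le

theorem pprod_le {b n : ℕ} (S : Finset ℕ) (hS : ∀ p ∈ S, p.Prime)
    (h : ∀ p, p.Prime → b ≤ p → p < n → p ∈ S) : pprod b n ≤ ∏ p ∈ S, p := by
  apply Finset.prod_le_prod_of_subset_of_one_le'
  · intro p hp
    rw [Finset.mem_filter, Finset.mem_range] at hp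
    exact h p hp.2.1 hp.2.2 hp.1
  · intro p hp _
    exact (hS p hp).one_lt.le

theorem pprod_mono {b b' n n' : ℕ} (hb : b' ≤ b) (hn : n ≤ n') : pprod b n ≤ pprod b' n' := by
  refine pprod_ge _ fun p hp => ?_
  rw [Finset.mem_filter, Finset.mem_range] at hp
  exact ⟨hp.2.1, hb.trans hp.2.2, by omega⟩

theorem pprod_step {b p n : ℕ} (hp : p.Prime) (hb : b ≤ p) (hn : p < n) :
    p * pprod b p ≤ pprod b n := by
  have := pprod_ge (b := b) (n := n)
    (insert p ((Finset.range p).filter (fun p => p.Prime ∧ b ≤ p))) (by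
      intro q hq
      rw [Finset.mem_insert, Finset.mem_filter, Finset.mem_range] at hq
      rcases hq with rfl | hq
      · exact ⟨hp, hb, hn⟩
      · exact ⟨hq.2.1, hq.2.2, by omega⟩)
  rwa [Finset.prod_insert (by simp)] at this

theorem pprod_29 {n : ℕ} (hn : 29 ≤ n) : 7436429 ≤ pprod 7 n := by
  have := pprod_ge (b := 7) (n := n) {7, 11, 13, 17, 19, 23} (by
    intro p hp
    simp only [Finset.mem_insert, Finset.mem_singleton] at hp
    rcases hp with rfl | rfl | rfl | rfl | rfl | rfl <;>
      exact ⟨by norm_num, by norm_num, by omega⟩)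
  simpa using this

theorem pprod_53 {n : ℕ} (hn : 53 ≤ n) : 20496120000000000 ≤ pprod 7 n := by
  have := pprod_ge (b := 7) (n := n) {7, 11, 13, 17, 19, 23, 29, 31, 37, 41, 43, 47} (by
    intro p hp
    simp only [Finset.mem_insert, Finset.mem_singleton] at hp
    rcases hp with rfl | rfl | rfl | rfl | rfl | rfl | rfl | rfl | rfl | rfl | rfl | rfl <;>
      exact ⟨by norm_num, by norm_num, by omega⟩)
  refine le_trans ?_ this
  simp

theorem pprod_big (n : ℕ) : 29 ≤ n → 4 * n ^ 8 < 37182145 * pprod 7 n := by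
  induction n using Nat.strong_induction_on with
  | _ n ih =>
    intro hn
    by_cases h53 : n ≤ 53
    · have h1 := pprod_29 hn
      have h2 : n ^ 8 ≤ 53 ^ 8 := Nat.pow_le_pow_left h53 8
      norm_num at h2
      omega
    · by_cases h800 : n ≤ 800
      · have h1 := pprod_53 (n := n) (by omega)
        have h2 : n ^ 8 ≤ 800 ^ 8 := Nat.pow_le_pow_left h800 8
        norm_num at h2
        omega
      · obtain ⟨p, hp, h1, h2⟩ := Nat.exists_prime_lt_and_le_two_mul ((n - 1) / 2) (by omega)
        have h3 := ih p (by omega) (by omega)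
        have h4 := pprod_step (b := 7) hp (by omega) (show p < n by omega)
        have h5 : n ^ 8 ≤ (2 * p) ^ 8 := Nat.pow_le_pow_left (by omega) 8
        have h6 : (2 * p) ^ 8 = 256 * p ^ 8 := by ring
        have h7 : 256 * (4 * p ^ 8) ≤ p * (4 * p ^ 8) := Nat.mul_le_mul_right _ (by omega)
        have h8 : p * (4 * p ^ 8) < p * (37182145 * pprod 7 p) :=
          Nat.mul_lt_mul_of_pos_left h3 hp.pos
        have h9 : p * (37182145 * pprod 7 p) = 37182145 * (p * pprod 7 p) := by ring
        omega

theorem num_four {l : ℕ} (hl : l.Prime) (h7 : 7 ≤ l) : l ^ 8 < 37182145 * pprod 7 l := by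
  by_cases h29 : 29 ≤ l
  · have := pprod_big l h29; omega
  · by_cases h13 : 17 ≤ l
    · have h := pprod_ge (b := 7) (n := l) {7, 11, 13} (by
        intro p hp
        simp only [Finset.mem_insert, Finset.mem_singleton] at hp
        rcases hp with rfl | rfl | rfl <;> exact ⟨by norm_num, by norm_num, by omega⟩)
      norm_num at h
      have hle : l ≤ 23 ∨ 23 < l := by omega
      rcases hle with hle | hle
      · by_cases h19 : l ≤ 19
        · have h2 : l ^ 8 ≤ 19 ^ 8 := Nat.pow_le_pow_left h19 8
          norm_num at h2
          omega
        · have h' := pprod_ge (b := 7) (n := l) {7, 11, 13, 17} (by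
            intro p hp
            simp only [Finset.mem_insert, Finset.mem_singleton] at hp
            rcases hp with rfl | rfl | rfl | rfl <;> exact ⟨by norm_num, by norm_num, by omega⟩)
          norm_num at h'
          have h2 : l ^ 8 ≤ 23 ^ 8 := Nat.pow_le_pow_left hle 8
          norm_num at h2
          omega
      · exfalso; interval_cases l <;> norm_num at hl
    · have h0 := pprod_ge (b := 7) (n := l) ∅ (by simp)
      rw [Finset.prod_empty] at h0
      by_cases h8 : l ≤ 7
      · have h2 : l ^ 8 ≤ 7 ^ 8 := Nat.pow_le_pow_left h8 8
        norm_num at h2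
        omega
      · have h := pprod_ge (b := 7) (n := l) {7} (by
          intro p hp
          rw [Finset.mem_singleton] at hp
          subst hp
          exact ⟨by norm_num, by norm_num, by omega⟩)
        rw [Finset.prod_singleton] at h
        by_cases h11 : l ≤ 11
        · have h2 : l ^ 8 ≤ 11 ^ 8 := Nat.pow_le_pow_left h11 8
          norm_num at h2
          omega
        · have h := pprod_ge (b := 7) (n := l) {7, 11} (by
            intro p hp
            simp only [Finset.mem_insert, Finset.mem_singleton] at hp
            rcases hp with rfl | rfl <;> exact ⟨by norm_num, by norm_num, by omega⟩)
          norm_num at h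
          have hle : l ≤ 13 ∨ 13 < l := by omega
          rcases hle with hle | hle
          · have h2 : l ^ 8 ≤ 13 ^ 8 := Nat.pow_le_pow_left hle 8
            norm_num at h2
            omega
          · exfalso; interval_cases l <;> norm_num at hl

theorem num_three {l : ℕ} (hl : l.Prime) : 4 * l ^ 8 < 37182145 * pprod 5 l := by
  by_cases h29 : 29 ≤ l
  · have := pprod_big l h29
    have h2 : pprod 7 l ≤ pprod 5 l := pprod_mono (by norm_num) le_rfl
    omega
  · have h0 := pprod_ge (b := 5) (n := l) ∅ (by simp)
    rw [Finset.prod_empty] at h0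
    by_cases h8 : l ≤ 7
    · have h2 : l ^ 8 ≤ 7 ^ 8 := Nat.pow_le_pow_left h8 8
      norm_num at h2
      omega
    · have h := pprod_ge (b := 5) (n := l) {5, 7} (by
        intro p hp
        simp only [Finset.mem_insert, Finset.mem_singleton] at hp
        rcases hp with rfl | rfl <;> exact ⟨by norm_num, by norm_num, by omega⟩)
      norm_num at h
      by_cases h11 : l ≤ 11
      · have h2 : l ^ 8 ≤ 11 ^ 8 := Nat.pow_le_pow_left h11 8
        norm_num at h2
        omega
      · have h := pprod_ge (b := 5) (n := l) {5, 7, 11} (by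
          intro p hp
          simp only [Finset.mem_insert, Finset.mem_singleton] at hp
          rcases hp with rfl | rfl | rfl <;> exact ⟨by norm_num, by norm_num, by omega⟩)
        norm_num at h
        have hle : l ≤ 13 ∨ 13 < l := by omega
        rcases hle with hle | hle
        · have h2 : l ^ 8 ≤ 13 ^ 8 := Nat.pow_le_pow_left hle 8
          norm_num at h2
          omega
        · have h := pprod_ge (b := 5) (n := l) {5, 7, 11, 13} (by
            intro p hp
            simp only [Finset.mem_insert, Finset.mem_singleton] at hp
            rcases hp with rfl | rfl | rfl | rfl <;> exact ⟨by norm_num, by norm_num, by omega⟩)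
          norm_num at h
          by_cases h19 : l ≤ 19
          · have h2 : l ^ 8 ≤ 19 ^ 8 := Nat.pow_le_pow_left h19 8
            norm_num at h2
            omega
          · have h := pprod_ge (b := 5) (n := l) {5, 7, 11, 13, 17} (by
              intro p hp
              simp only [Finset.mem_insert, Finset.mem_singleton] at hp
              rcases hp with rfl | rfl | rfl | rfl | rfl <;>
                exact ⟨by norm_num, by norm_num, by omega⟩)
            norm_num at h
            have hle : l ≤ 23 ∨ 23 < l := by omega
            rcases hle with hle | hle
            · have h2 : l ^ 8 ≤ 23 ^ 8 := Nat.pow_le_pow_left hle 8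
              norm_num at h2
              omega
            · exfalso; interval_cases l <;> norm_num at hl

theorem num_two {l Y : ℕ} (h1 : 37182145 ≤ Y) (h2 : pprod 5 l ≤ Y) : 4 * l ^ 4 < Y := by
  by_cases h53 : l ≤ 53
  · have h3 : l ^ 4 ≤ 53 ^ 4 := Nat.pow_le_pow_left h53 4
    norm_num at h3
    omega
  · have h4 : pprod 7 l ≤ pprod 5 l := pprod_mono (by norm_num) le_rfl
    by_cases h800 : l ≤ 800
    · have h5 := pprod_53 (n := l) (by omega)
      have h3 : l ^ 4 ≤ 800 ^ 4 := Nat.pow_le_pow_left h800 4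
      norm_num at h3
      omega
    · have h5 := pprod_big l (by omega)
      have h3 : 800 ^ 4 ≤ l ^ 4 := Nat.pow_le_pow_left (by omega) 4
      norm_num at h3
      have h6 : l ^ 8 = l ^ 4 * l ^ 4 := by ring
      rw [h6] at h5
      nlinarith

theorem min_seven (P : Finset ℕ) (hP : ∀ p ∈ P, p.Prime ∧ 5 ≤ p) (hc : 7 ≤ P.card) :
    37182145 ≤ ∏ p ∈ P, p := by
  obtain ⟨S, hS⟩ : ∃ S : Finset ℕ, S = {5, 7, 11, 13, 17, 19, 23} := ⟨_, rfl⟩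
  have hSp : ∏ p ∈ S, p = 37182145 := by rw [hS]; simp
  have hSc : S.card = 7 := by rw [hS]; rfl
  have hS23 : ∀ p ∈ S, p ≤ 23 := by
    intro p hp
    rw [hS] at hp
    simp only [Finset.mem_insert, Finset.mem_singleton] at hp
    omega
  have hlarge : ∀ p ∈ P \ S, 23 ≤ p := by
    intro p hp
    rw [Finset.mem_sdiff] at hp
    obtain ⟨h1, h2⟩ := hP p hp.1
    have h3 := hp.2
    rw [hS] at h3
    simp only [Finset.mem_insert, Finset.mem_singleton] at h3
    by_contra hlt
    interval_cases p <;> first | omega | norm_num at h1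
  have hcard : (S \ P).card ≤ (P \ S).card := by
    have e1 := Finset.card_sdiff_add_card_inter S P
    have e2 := Finset.card_sdiff_add_card_inter P S
    rw [Finset.inter_comm] at e2
    omega
  have h1 : ∏ p ∈ S \ P, p ≤ 23 ^ (S \ P).card :=
    Finset.prod_le_pow_card _ _ _ fun p hp => hS23 p (Finset.mem_sdiff.1 hp).1
  have h2 : 23 ^ (P \ S).card ≤ ∏ p ∈ P \ S, p :=
    Finset.pow_card_le_prod _ _ _ hlarge
  have h3 : 23 ^ (S \ P).card ≤ 23 ^ (P \ S).card := Nat.pow_le_pow_right (by norm_num) hcard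
  rw [← hSp, ← Finset.prod_inter_mul_prod_diff S P, ← Finset.prod_inter_mul_prod_diff P S,
    Finset.inter_comm S P]
  exact Nat.mul_le_mul_left _ ((h1.trans h3).trans h2)

theorem exists_least (b : ℕ) (S : Finset ℕ) : ∃ l, l.Prime ∧ b ≤ l ∧ l ∉ S ∧
    ∀ p, p.Prime → b ≤ p → p < l → p ∈ S := by
  classical
  have hex : ∃ l, l.Prime ∧ b ≤ l ∧ l ∉ S := by
    obtain ⟨l, h1, h2⟩ := Nat.exists_infinite_primes (b + S.sup id + 1)
    refine ⟨l, h2, by omega, fun h => ?_⟩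
    have := Finset.le_sup (f := id) h
    simp only [id] at this
    omega
  refine ⟨Nat.find hex, (Nat.find_spec hex).1, (Nat.find_spec hex).2.1, (Nat.find_spec hex).2.2, ?_⟩
  intro p h1 h2 h3
  by_contra h
  exact Nat.find_min hex h3 ⟨h1, h2, h⟩

end Numerics

/-! ### Part 9: assembly -/

section Assembly

variable {G : Matrix (Fin 4) (Fin 4) ℤ}

theorem Cfg.reindex {Pp Pq : Finset ℕ} {v : Fin 4 → Fin 4 → ℤ} (c : Cfg G Pp Pq v)
    (f : Fin 4 → Fin 4) (hf : Function.Injective f) : Cfg G Pp Pq (v ∘ f) := by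
  have hcard : ∀ A : Fin 4 → Prop, ∀ [DecidablePred A],
      (Finset.univ.filter fun i => A (f i)).card = (Finset.univ.filter fun i => A i).card := by
    intro A _
    refine Finset.card_bij (fun i _ => f i) ?_ ?_ ?_
    · intro i hi; simpa using hi
    · intro i _ j _ h; exact hf h
    · intro j hj
      obtain ⟨i, rfl⟩ := (Finite.injective_iff_surjective.1 hf) j
      exact ⟨i, by simpa using hj, rfl⟩
  refine ⟨c.hs, c.hp, c.hsf, c.htr, fun i => c.hv (f i), c.hli.comp f hf, c.prime, c.dis, ?_, ?_⟩
  · intro p hp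
    rw [← c.two p hp]
    exact hcard (fun i => (p : ℤ) ∣ Bf G (v i) (v i))
  · intro p hp
    rw [← c.one p hp]
    exact hcard (fun i => (p : ℤ) ∣ Bf G (v i) (v i))

theorem big_prod {Pp Pq : Finset ℕ} (hdis : Disjoint Pp Pq)
    (hP : ∀ p ∈ Pp ∪ Pq, p.Prime ∧ 5 ≤ p) (hcard : 7 ≤ (Pp ∪ Pq).card) {b l : ℕ}
    (hall : ∀ p, p.Prime → b ≤ p → p < l → p ∈ Pp) :
    37182145 * pprod b l ≤ (∏ p ∈ Pp, p ^ 2) * ∏ p ∈ Pq, p := by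
  have h1 := min_seven _ hP hcard
  have h2 := pprod_le (b := b) (n := l) Pp (fun p hp => (hP p (Finset.mem_union_left _ hp)).1) hall
  rw [Finset.prod_union hdis] at h1
  have h3 := Nat.mul_le_mul h1 h2
  refine h3.trans (le_of_eq ?_)
  rw [Finset.prod_pow]
  ring

theorem card_one_unique {A : Fin 4 → Prop} [DecidablePred A]
    (h : (Finset.univ.filter fun i => A i).card = 1) {i j : Fin 4} (hi : A i) (hj : A j) :
    i = j := by
  obtain ⟨k, hk⟩ := Finset.card_eq_one.1 h
  have h1 : i ∈ (Finset.univ.filter fun i => A i) := by simpa using hi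
  have h2 : j ∈ (Finset.univ.filter fun i => A i) := by simpa using hj
  rw [hk, Finset.mem_singleton] at h1 h2
  rw [h1, h2]

theorem fin_four (i : Fin 4) : ∃ f : Fin 4 → Fin 4, Function.Injective f ∧ f 3 = i :=
  ⟨Equiv.swap i 3, (Equiv.swap i 3).injective, Equiv.swap_apply_right i 3⟩

theorem fin_pair {i j : Fin 4} (h : i ≠ j) :
    ∃ f : Fin 4 → Fin 4, Function.Injective f ∧ f 0 = i ∧ f 1 = j := by
  have hk : Equiv.swap 0 i j ≠ 0 := by
    intro h0
    have := congrArg (Equiv.swap 0 i) h0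
    rw [Equiv.swap_apply_self, Equiv.swap_apply_left] at this
    exact h this.symm
  refine ⟨fun x => Equiv.swap 0 i (Equiv.swap 1 (Equiv.swap 0 i j) x), ?_, ?_, ?_⟩
  · exact (Equiv.swap 0 i).injective.comp (Equiv.swap 1 _).injective
  · show Equiv.swap 0 i (Equiv.swap 1 (Equiv.swap 0 i j) 0) = i
    rw [Equiv.swap_apply_of_ne_of_ne (by decide) hk.symm, Equiv.swap_apply_left]
  · show Equiv.swap 0 i (Equiv.swap 1 (Equiv.swap 0 i j) 1) = j
    rw [Equiv.swap_apply_left, Equiv.swap_apply_self]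

theorem four_false {Pp Pq : Finset ℕ} {v : Fin 4 → Fin 4 → ℤ} (c : Cfg G Pp Pq v)
    (hcard : 7 ≤ (Pp ∪ Pq).card)
    (hzero : ∀ l : ℕ, l.Prime → 5 ≤ l → l ∉ Pp ∪ Pq → ∀ i, ¬ (l : ℤ) ∣ Bf G (v i) (v i))
    (sep : ∀ i j, i ≠ j → SepL G (Pp ∪ Pq) (v i) (v j)) : False := by
  obtain ⟨l, hl, h7, hnot, hall⟩ := exists_least 7 Pp
  have key : ∃ i0 : Fin 4, ∀ j, j ≠ i0 → ¬ (l : ℤ) ∣ Bf G (v j) (v j) := by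
    by_cases hq : l ∈ Pq
    · obtain ⟨k, hk⟩ := Finset.card_eq_one.1 (c.one l hq)
      refine ⟨k, fun j hj h => hj ?_⟩
      have : j ∈ (Finset.univ.filter fun i => (l : ℤ) ∣ Bf G (v i) (v i)) := by simpa using h
      rw [hk, Finset.mem_singleton] at this
      exact this
    · exact ⟨0, fun j _ => hzero l hl (by omega) (by simp [hnot, hq]) j⟩
  obtain ⟨i0, hi0⟩ := key
  obtain ⟨f, hf, hf3⟩ := fin_four i0
  have hne : ∀ j, j ≠ 3 → f j ≠ i0 := fun j hj h => hj (hf (h.trans hf3.symm))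
  exact cfgFour (c.reindex f hf) (fun i j hij => sep (f i) (f j) (fun h => hij (hf h))) hl h7
    (hi0 _ (hne 0 (by decide))) (hi0 _ (hne 1 (by decide))) (hi0 _ (hne 2 (by decide)))
    ((num_four hl h7).trans_le (big_prod c.dis c.prime hcard hall))

theorem three_false {Pp Pq : Finset ℕ} {v : Fin 4 → Fin 4 → ℤ} (c : Cfg G Pp Pq v)
    (hcard : 7 ≤ (Pp ∪ Pq).card)
    (hzero : ∀ l : ℕ, l.Prime → 5 ≤ l → l ∉ Pp ∪ Pq → ∀ i, ¬ (l : ℤ) ∣ Bf G (v i) (v i))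
    (same : ∀ p ∈ Pp ∪ Pq, ((p : ℤ) ∣ Bf G (v 0) (v 0) ↔ (p : ℤ) ∣ Bf G (v 1) (v 1)))
    (s02 : SepL G (Pp ∪ Pq) (v 0) (v 2)) (s03 : SepL G (Pp ∪ Pq) (v 0) (v 3))
    (s23 : SepL G (Pp ∪ Pq) (v 2) (v 3)) : False := by
  obtain ⟨l, hl, h5, hnot, hall⟩ := exists_least 5 Pp
  have hbig := (num_three hl).trans_le (big_prod c.dis c.prime hcard hall)
  have s12 : SepL G (Pp ∪ Pq) (v 1) (v 2) := by
    obtain ⟨p, hp, h⟩ := s02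
    exact ⟨p, hp, by rw [← same p hp]; exact h⟩
  have s13 : SepL G (Pp ∪ Pq) (v 1) (v 3) := by
    obtain ⟨p, hp, h⟩ := s03
    exact ⟨p, hp, by rw [← same p hp]; exact h⟩
  have uniq : ∀ i j, (l : ℤ) ∣ Bf G (v i) (v i) → (l : ℤ) ∣ Bf G (v j) (v j) → i = j := by
    intro i j hi hj
    by_cases hq : l ∈ Pq
    · exact card_one_unique (A := fun i => (l : ℤ) ∣ Bf G (v i) (v i)) (c.one l hq) hi hj
    · exact absurd hi (hzero l hl h5 (by simp [hnot, hq]) i)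
  have mem : ∀ i, (l : ℤ) ∣ Bf G (v i) (v i) → l ∈ Pp ∪ Pq := by
    intro i hi
    by_contra h
    exact hzero l hl h5 h i hi
  have h0 : ¬ (l : ℤ) ∣ Bf G (v 0) (v 0) := fun h =>
    absurd (uniq 0 1 h ((same l (mem 0 h)).1 h)) (by decide)
  have h1 : ¬ (l : ℤ) ∣ Bf G (v 1) (v 1) := fun h =>
    absurd (uniq 0 1 ((same l (mem 1 h)).2 h) h) (by decide)
  by_cases h2 : (l : ℤ) ∣ Bf G (v 2) (v 2)
  · have h3 : ¬ (l : ℤ) ∣ Bf G (v 3) (v 3) := fun h => absurd (uniq 2 3 h2 h) (by decide)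
    have s32 : SepL G (Pp ∪ Pq) (v 3) (v 2) := by
      obtain ⟨p, hp, h⟩ := s23
      exact ⟨p, hp, fun h' => h h'.symm⟩
    exact cfgThree (c.reindex ![0, 1, 3, 2] (by decide)) same s03 s02 s13 s12 s32 hl h5 h0 h1 h3
      hbig
  · exact cfgThree c same s02 s03 s12 s13 s23 hl h5 h0 h1 h2 hbig

theorem key_diff {A0 A1 A2 A3 : Prop} [Decidable A0] [Decidable A1] [Decidable A2]
    [Decidable A3] (hs : A0 ↔ A1) (ho : (A0 ↔ A2) ∨ (A2 ↔ A3))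
    (h : (if A0 then 1 else 0) + (if A1 then 1 else 0)
      + (if A2 then 1 else 0) + (if A3 then 1 else 0) = 1 ∨
      (if A0 then 1 else 0) + (if A1 then 1 else 0)
      + (if A2 then 1 else 0) + (if A3 then 1 else 0) = 2) : ¬ (A0 ↔ A3) := by
  by_cases a0 : A0 <;> by_cases a2 : A2 <;> by_cases a3 : A3 <;> simp_all

theorem two_false {Pp Pq : Finset ℕ} {v : Fin 4 → Fin 4 → ℤ} (c : Cfg G Pp Pq v)
    (hcard : 7 ≤ (Pp ∪ Pq).card)
    (hzero : ∀ l : ℕ, l.Prime → 5 ≤ l → l ∉ Pp ∪ Pq → ∀ i, ¬ (l : ℤ) ∣ Bf G (v i) (v i))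
    (same : ∀ p ∈ Pp ∪ Pq, ((p : ℤ) ∣ Bf G (v 0) (v 0) ↔ (p : ℤ) ∣ Bf G (v 1) (v 1)))
    (hor : (∀ p ∈ Pp ∪ Pq, ((p : ℤ) ∣ Bf G (v 0) (v 0) ↔ (p : ℤ) ∣ Bf G (v 2) (v 2))) ∨
      (∀ p ∈ Pp ∪ Pq, ((p : ℤ) ∣ Bf G (v 2) (v 2) ↔ (p : ℤ) ∣ Bf G (v 3) (v 3)))) : False := by
  obtain ⟨l, hl, h5, hnot, hall⟩ := exists_least 5 (Pp ∪ Pq)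
  have hz := hzero l hl h5 hnot
  refine cfgTwo c same ?_ hl h5 (hz 0) (hz 1) (hz 3)
    (num_two (min_seven _ c.prime hcard) (pprod_le _ (fun p hp => (c.prime p hp).1) hall))
  intro p hp
  refine key_diff (A2 := (p : ℤ) ∣ Bf G (v 2) (v 2)) (same p hp) ?_ ?_
  · rcases hor with h | h
    · exact Or.inl (h p hp)
    · exact Or.inr (h p hp)
  · rcases Finset.mem_union.1 hp with h | h
    · right; have := c.two p h; rwa [Finset.card_filter, Fin.sum_univ_four] at this
    · left; have := c.one p h; rwa [Finset.card_filter, Fin.sum_univ_four] at this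

theorem not_sep {P : Finset ℕ} {u v : Fin 4 → ℤ} (h : ¬ SepL G P u v) :
    ∀ p ∈ P, ((p : ℤ) ∣ Bf G u u ↔ (p : ℤ) ∣ Bf G v v) := by
  intro p hp
  by_contra hn
  exact h ⟨p, hp, hn⟩

theorem cfg_false {Pp Pq : Finset ℕ} {v : Fin 4 → Fin 4 → ℤ} (c : Cfg G Pp Pq v)
    (hcard : 7 ≤ (Pp ∪ Pq).card)
    (hzero : ∀ l : ℕ, l.Prime → 5 ≤ l → l ∉ Pp ∪ Pq → ∀ i, ¬ (l : ℤ) ∣ Bf G (v i) (v i)) :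
    False := by
  by_cases hall : ∀ i j, i ≠ j → SepL G (Pp ∪ Pq) (v i) (v j)
  · exact four_false c hcard hzero hall
  · push Not at hall
    obtain ⟨i, j, hij, hns⟩ := hall
    obtain ⟨f, hf, hfi, hfj⟩ := fin_pair hij
    have c' := c.reindex f hf
    have hz' : ∀ l : ℕ, l.Prime → 5 ≤ l → l ∉ Pp ∪ Pq →
        ∀ i, ¬ (l : ℤ) ∣ Bf G ((v ∘ f) i) ((v ∘ f) i) := fun l h1 h2 h3 i => hzero l h1 h2 h3 (f i)
    have hns' : ¬ SepL G (Pp ∪ Pq) ((v ∘ f) 0) ((v ∘ f) 1) := by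
      simp only [Function.comp_apply, hfi, hfj]; exact hns
    have same := not_sep hns'
    generalize v ∘ f = w at *
    by_cases s02 : SepL G (Pp ∪ Pq) (w 0) (w 2)
    · by_cases s03 : SepL G (Pp ∪ Pq) (w 0) (w 3)
      · by_cases s23 : SepL G (Pp ∪ Pq) (w 2) (w 3)
        · exact three_false c' hcard hz' same s02 s03 s23
        · exact two_false c' hcard hz' same (Or.inr (not_sep s23))
      · exact two_false (c'.reindex ![0, 1, 3, 2] (by decide)) hcard
          (fun l h1 h2 h3 i => hz' l h1 h2 h3 _) same (Or.inl (not_sep s03))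
    · exact two_false c' hcard hz' same (Or.inl (not_sep s02))

theorem not_dvd_prod_pow {x k : ℕ} (hx : x.Prime) (S : Finset ℕ) (hS : ∀ y ∈ S, y.Prime)
    (h : x ∉ S) : ¬ x ∣ ∏ y ∈ S, y ^ k := by
  rw [hx.prime.dvd_finsetProd_iff]
  rintro ⟨y, hy, hd⟩
  have := hx.dvd_of_dvd_pow hd
  rw [Nat.prime_dvd_prime_iff_eq hx (hS y hy)] at this
  exact h (this ▸ hy)

theorem valuation (Up Uq : Finset ℕ) (hp : ∀ y ∈ Up, y.Prime) (hq : ∀ y ∈ Uq, y.Prime)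
    (hdis : Disjoint Up Uq) (x : ℕ) (hx : x.Prime) :
    ∃ M, (∏ y ∈ Up, y ^ 2) * ∏ y ∈ Uq, y ^ 1
      = x ^ (if x ∈ Up then 2 else if x ∈ Uq then 1 else 0) * M ∧ ¬ x ∣ M := by
  by_cases h1 : x ∈ Up
  · have h2 : x ∉ Uq := Finset.disjoint_left.1 hdis h1
    refine ⟨(∏ y ∈ Up.erase x, y ^ 2) * ∏ y ∈ Uq, y ^ 1, ?_, ?_⟩
    · rw [← Finset.mul_prod_erase Up (fun y => y ^ 2) h1, if_pos h1]; ring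
    · rw [hx.dvd_mul, not_or]
      exact ⟨not_dvd_prod_pow hx _ (fun y hy => hp y (Finset.mem_of_mem_erase hy)) (by simp),
        not_dvd_prod_pow hx _ hq h2⟩
  · by_cases h2 : x ∈ Uq
    · refine ⟨(∏ y ∈ Up, y ^ 2) * ∏ y ∈ Uq.erase x, y ^ 1, ?_, ?_⟩
      · rw [← Finset.mul_prod_erase Uq (fun y => y ^ 1) h2, if_neg h1, if_pos h2]; ring
      · rw [hx.dvd_mul, not_or]
        exact ⟨not_dvd_prod_pow hx _ hp h1,
          not_dvd_prod_pow hx _ (fun y hy => hq y (Finset.mem_of_mem_erase hy)) (by simp)⟩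
    · refine ⟨_, by rw [if_neg h1, if_neg h2, pow_zero, one_mul], ?_⟩
      rw [hx.dvd_mul, not_or]
      exact ⟨not_dvd_prod_pow hx _ hp h1, not_dvd_prod_pow hx _ hq h2⟩

theorem sameGenus_refl (G : Matrix (Fin 4) (Fin 4) ℤ) : SameGenusM G G := by
  intro p _
  exact ⟨1, by simp, by simp⟩

theorem main_finset (hs : G.IsSymm) (hp : PosDefM G) (hsf : SquareFreeM G)
    (htr : TotallyReflectiveM G) (Up Uq : Finset ℕ) (hUp : ∀ y ∈ Up, y.Prime)
    (hUq : ∀ y ∈ Uq, y.Prime) (hdis : Disjoint Up Uq)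
    (hdet : G.det = (((∏ y ∈ Up, y ^ 2) * ∏ y ∈ Uq, y : ℕ) : ℤ))
    (hcard : 9 ≤ (Up ∪ Uq).card) : False := by
  obtain ⟨v, hv, hli⟩ := exists_roots (htr G hs hp (sameGenus_refl G))
  obtain ⟨Pp, hPp⟩ : ∃ Pp, Pp = Up.filter (fun x => 5 ≤ x) := ⟨_, rfl⟩
  obtain ⟨Pq, hPq⟩ : ∃ Pq, Pq = Uq.filter (fun x => 5 ≤ x) := ⟨_, rfl⟩
  have hpr : ∀ x ∈ Up ∪ Uq, x.Prime := by
    intro x hx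
    rcases Finset.mem_union.1 hx with h | h
    · exact hUp x h
    · exact hUq x h
  have hPeq : Pp ∪ Pq = (Up ∪ Uq).filter (fun x => 5 ≤ x) := by
    rw [hPp, hPq, Finset.filter_union]
  have hP5 : ∀ x ∈ Pp ∪ Pq, x.Prime ∧ 5 ≤ x := by
    intro x hx
    rw [hPeq, Finset.mem_filter] at hx
    exact ⟨hpr x hx.1, hx.2⟩
  have hPdis : Disjoint Pp Pq := by
    rw [hPp, hPq]; exact Finset.disjoint_filter_filter hdis
  have hPcard : 7 ≤ (Pp ∪ Pq).card := by
    have hsub : Up ∪ Uq ⊆ (Pp ∪ Pq) ∪ {2, 3} := by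
      intro x hx
      rw [Finset.mem_union, hPeq, Finset.mem_filter]
      by_cases h5 : 5 ≤ x
      · exact Or.inl ⟨hx, h5⟩
      · right
        have h := hpr x hx
        have h2 := h.two_le
        interval_cases x
        · simp
        · simp
        · norm_num at h
    have h1 := Finset.card_le_card hsub
    have h2 := Finset.card_union_le (Pp ∪ Pq) {2, 3}
    have h3 : ({2, 3} : Finset ℕ).card = 2 := rfl
    omega
  have hval : ∀ x : ℕ, x.Prime → ∃ M : ℕ, G.det
      = ((x ^ (if x ∈ Up then 2 else if x ∈ Uq then 1 else 0) * M : ℕ) : ℤ) ∧ ¬ x ∣ M := by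
    intro x hx
    obtain ⟨M, h1, h2⟩ := valuation Up Uq hUp hUq hdis x hx
    simp only [pow_one] at h1
    exact ⟨M, by rw [hdet, h1], h2⟩
  have hD : G.det ≠ 0 := by
    rw [hdet]
    have : (∏ y ∈ Up, y ^ 2) * ∏ y ∈ Uq, y ≠ 0 := by
      apply mul_ne_zero
      · exact Finset.prod_ne_zero_iff.2 fun y hy => pow_ne_zero 2 (hUp y hy).ne_zero
      · exact Finset.prod_ne_zero_iff.2 fun y hy => (hUq y hy).ne_zero
    exact_mod_cast this
  have hpadic : ∀ x : ℕ, x.Prime → padicValInt x G.det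
      = if x ∈ Up then 2 else if x ∈ Uq then 1 else 0 := by
    intro x hx
    have := Fact.mk hx
    obtain ⟨M, h1, h2⟩ := hval x hx
    have hM : M ≠ 0 := by rintro rfl; exact h2 (dvd_zero _)
    rw [h1, padicValInt, Int.natAbs_natCast, padicValNat.mul (pow_ne_zero _ hx.ne_zero) hM,
      padicValNat.prime_pow, padicValNat.eq_zero_of_not_dvd h2, add_zero]
  have hPdet : ∀ x ∈ Pp ∪ Pq, x.Prime ∧ 5 ≤ x ∧ (x : ℤ) ∣ G.det ∧ ¬ (x : ℤ) ^ 3 ∣ G.det := by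
    intro x hx
    obtain ⟨h1, h2⟩ := hP5 x hx
    have := Fact.mk h1
    rw [hPeq, Finset.mem_filter] at hx
    have hv := hpadic x h1
    refine ⟨h1, h2, ?_, ?_⟩
    · have : (x : ℤ) ^ 1 ∣ G.det := by
        rw [padicValInt_dvd_iff]
        right
        rw [hv]
        rcases Finset.mem_union.1 hx.1 with h | h
        · rw [if_pos h]; norm_num
        · split_ifs <;> norm_num
      rwa [pow_one] at this
    · rw [padicValInt_dvd_iff]
      rintro (h | h)
      · exact hD h
      · rw [hv] at h
        split_ifs at h <;> omega
  have hroots := four_roots hs hp hsf hv hli (Pp ∪ Pq) hPdet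
    (by have := min_seven _ hP5 hPcard; omega) hD
  have c : Cfg G Pp Pq v := by
    refine ⟨hs, hp, hsf, htr, fun i => root_RL hp (hv i), hli, hP5, hPdis, ?_, ?_⟩
    · intro x hx
      obtain ⟨h1, h2⟩ := hP5 x (Finset.mem_union_left _ hx)
      rw [hroots x h1 h2, hpadic x h1, if_pos]
      rw [hPp, Finset.mem_filter] at hx
      exact hx.1
    · intro x hx
      obtain ⟨h1, h2⟩ := hP5 x (Finset.mem_union_right _ hx)
      rw [hPq, Finset.mem_filter] at hx
      rw [hroots x h1 h2, hpadic x h1, if_neg (Finset.disjoint_right.1 hdis hx.1), if_pos hx.1]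
  refine cfg_false c hPcard ?_
  intro l hl h5 hnot i hi
  have h1 := hroots l hl h5
  rw [hPeq, Finset.mem_filter, Finset.mem_union] at hnot
  have hn1 : l ∉ Up := fun h => hnot ⟨Or.inl h, h5⟩
  have hn2 : l ∉ Uq := fun h => hnot ⟨Or.inr h, h5⟩
  rw [hpadic l hl, if_neg hn1, if_neg hn2, Finset.card_eq_zero] at h1
  have : i ∈ (Finset.univ.filter fun i => (l : ℤ) ∣ Bf G (v i) (v i)) := by simpa using hi
  rw [h1] at this
  simp at this

end Assembly

/-- Theorem 3.8(b): if a strongly square free, totally-reflective, positive definite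
quaternary lattice has determinant `p₁²⋯p_r²·q₁⋯q_s` with pairwise distinct primes, then
`r ≤ 9` and `s ≤ 8 − r`. -/
theorem ssf_totally_reflective_dim4_num_primes
    (G : Matrix (Fin 4) (Fin 4) ℤ) (hsymm : G.IsSymm) (hpos : PosDefM G)
    (hssf : StronglySquareFreeM G) (htr : TotallyReflectiveM G)
    (r s : ℕ) (p : Fin r → ℕ) (q : Fin s → ℕ)
    (hp : ∀ i, (p i).Prime) (hq : ∀ j, (q j).Prime)
    (hinjp : Function.Injective p) (hinjq : Function.Injective q)
    (hdisj : ∀ i j, p i ≠ q j)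
    (hdet : G.det = (∏ i, (p i : ℤ) ^ 2) * ∏ j, (q j : ℤ)) :
    r ≤ 9 ∧ (s : ℤ) ≤ 8 - (r : ℤ) := by
  have hle : r + s ≤ 8 := by
    by_contra hlt
    have hdis : Disjoint (Finset.univ.image p) (Finset.univ.image q) := by
      rw [Finset.disjoint_left]
      intro x hx hx'
      obtain ⟨i, _, rfl⟩ := Finset.mem_image.1 hx
      obtain ⟨j, _, h⟩ := Finset.mem_image.1 hx'
      exact hdisj i j h.symm
    refine main_finset hsymm hpos hssf.1 htr (Finset.univ.image p) (Finset.univ.image q)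
      ?_ ?_ hdis ?_ ?_
    · intro y hy
      obtain ⟨i, _, rfl⟩ := Finset.mem_image.1 hy
      exact hp i
    · intro y hy
      obtain ⟨i, _, rfl⟩ := Finset.mem_image.1 hy
      exact hq i
    · rw [hdet, Finset.prod_image (fun i _ j _ h => hinjp h),
        Finset.prod_image (fun i _ j _ h => hinjq h)]
      push_cast
      rfl
    · rw [Finset.card_union_of_disjoint hdis, Finset.card_image_of_injective _ hinjp,
        Finset.card_image_of_injective _ hinjq, Finset.card_univ, Finset.card_univ,
        Fintype.card_fin, Fintype.card_fin]
      omega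
  constructor
  · omega
  · omega
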